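/- The rootlet map restricts to a bijection from the set of maximal abelian ideals onto the set Π_l of long simple roots: (1) if I is an abelian ideal maximal with respect to inclusion among all abelian ideals, then τ(I) ∈ Π_l; and (2) for every α ∈ Π_l there is exactly one maximal abelian ideal I with τ(I) = α. -/

import Mathlib

open scoped BigOperators

/-- Data of a reduced irreducible crystallographic root system `Δ`, spanning a
`ℚ`-vector space `V` equipped with a Weyl-group-invariant inner product `B`,
together with a chosen system of positive roots `Pos` and the highest root `θ`. -/
structure RootSystemCtx (V : Type*) [AddCommGroup V] [Module ℚ V] where
  /-- the invariant inner product `( , )` -/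
  B : V →ₗ[ℚ] V →ₗ[ℚ] ℚ
  B_symm : ∀ x y : V, B x y = B y x
  B_posdef : ∀ x : V, x ≠ 0 → 0 < B x x
  /-- the set of roots -/
  Δ : Set V
  Δ_finite : Δ.Finite
  Δ_spans : Submodule.span ℚ Δ = ⊤
  zero_notMem_Δ : (0 : V) ∉ Δ
  neg_mem_Δ : ∀ α ∈ Δ, -α ∈ Δ
  reduced : ∀ α ∈ Δ, ∀ c : ℚ, c • α ∈ Δ → c = 1 ∨ c = -1
  crystallographic : ∀ α ∈ Δ, ∀ β ∈ Δ, ∃ n : ℤ, 2 * B α β / B β β = (n : ℚ)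
  reflect_mem : ∀ α ∈ Δ, ∀ β ∈ Δ, β - (2 * B β α / B α α) • α ∈ Δ
  irreducible : ∀ S : Set V, S ⊆ Δ → (∀ α ∈ S, ∀ β ∈ Δ \ S, B α β = 0) → S = ∅ ∨ S = Δ
  /-- the positive roots `Δ⁺` -/
  Pos : Set V
  pos_subset : Pos ⊆ Δ
  mem_pos_or_neg_pos : ∀ α ∈ Δ, α ∈ Pos ∨ -α ∈ Pos
  pos_not_neg : ∀ α ∈ Pos, -α ∉ Pos
  add_pos_mem : ∀ α ∈ Pos, ∀ β ∈ Pos, α + β ∈ Δ → α + β ∈ Pos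
  /-- the highest root `θ` -/
  θ : V
  θ_pos : θ ∈ Pos
  θ_highest : ∀ ν ∈ Δ, θ - ν ∈ AddSubmonoid.closure Pos

namespace RootSystemCtx

variable {V : Type*} [AddCommGroup V] [Module ℚ V] (ctx : RootSystemCtx V)

/-- the simple roots `Π`: indecomposable positive roots -/
def simple : Set V :=
  {α | α ∈ ctx.Pos ∧ ¬∃ β ∈ ctx.Pos, ∃ γ ∈ ctx.Pos, α = β + γ}

/-- `ρ`, the half-sum of all positive roots -/
noncomputable def ρ : V :=
  (1 / 2 : ℚ) • ∑ α ∈ (ctx.Δ_finite.subset ctx.pos_subset).toFinset, α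

/-- the coroot `μ∨ = 2μ/(μ,μ)` -/
noncomputable def coroot (μ : V) : V := (2 / ctx.B μ μ) • μ

/-- `Δ⁺_l`, the long positive roots (roots of the same length as `θ`) -/
def PosLong : Set V := {μ | μ ∈ ctx.Pos ∧ ctx.B μ μ = ctx.B ctx.θ ctx.θ}

/-- `Π_l`, the long simple roots -/
def SimpleLong : Set V := {μ | μ ∈ ctx.simple ∧ ctx.B μ μ = ctx.B ctx.θ ctx.θ}

/-- the dominance order `μ ≼ ν` on the root lattice: `ν - μ` is a nonnegative
integer combination of positive roots -/
def le (μ ν : V) : Prop := ν - μ ∈ AddSubmonoid.closure ctx.Pos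

/-- a (combinatorial) abelian ideal of `Δ⁺` -/
def IsAbelianIdeal (I : Set V) : Prop :=
  I ⊆ ctx.Pos ∧ (∀ μ ∈ I, ∀ ν ∈ I, μ + ν ∉ ctx.Δ) ∧
    ∀ γ ∈ I, ∀ ν ∈ ctx.Pos, γ + ν ∈ ctx.Δ → γ + ν ∈ I

/-- `γ` is a generator of the ideal `I` -/
def IsGenerator (I : Set V) (γ : V) : Prop := γ ∈ I ∧ ∀ α ∈ ctx.Pos, γ - α ∉ I

/-! ### The affine picture: `V̂ = V ⊕ ℚδ ⊕ ℚλ`, modelled as `V × ℚ × ℚ`,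
with `δ = (0,1,0)` and `λ = (0,0,1)`. -/

/-- the embedding of `V` into `V̂` -/
def emb (_ctx : RootSystemCtx V) (v : V) : V × ℚ × ℚ := (v, 0, 0)

/-- the imaginary root `δ` -/
def δhat (_ctx : RootSystemCtx V) : V × ℚ × ℚ := (0, 1, 0)

/-- the affine simple root `α₀ = δ - θ` -/
def alpha0 : V × ℚ × ℚ := (-ctx.θ, 1, 0)

/-- the extension of the inner product to `V̂`, with
`(δ,V)=(λ,V)=(δ,δ)=(λ,λ)=0` and `(δ,λ)=1` -/
noncomputable def Bhat : (V × ℚ × ℚ) →ₗ[ℚ] (V × ℚ × ℚ) →ₗ[ℚ] ℚ :=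
  LinearMap.mk₂ ℚ (fun x y => ctx.B x.1 y.1 + x.2.1 * y.2.2 + x.2.2 * y.2.1)
    (fun x x' y => by
      simp only [Prod.fst_add, Prod.snd_add, map_add, LinearMap.add_apply]; ring)
    (fun c x y => by
      simp only [Prod.smul_fst, Prod.smul_snd, map_smul, LinearMap.smul_apply,
        smul_eq_mul]; ring)
    (fun x y y' => by
      simp only [Prod.fst_add, Prod.snd_add, map_add]; ring)
    (fun c x y => by
      simp only [Prod.smul_fst, Prod.smul_snd, map_smul, smul_eq_mul]; ring)

/-- the set `Δ̂` of affine real roots -/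
def Δhat : Set (V × ℚ × ℚ) := {x | ∃ α ∈ ctx.Δ, ∃ k : ℤ, x = (α, (k : ℚ), 0)}

/-- the set `Δ̂⁺` of positive affine roots -/
def PosHat : Set (V × ℚ × ℚ) :=
  {x | ∃ α ∈ ctx.Pos, x = (α, 0, 0)} ∪
    {x | ∃ α ∈ ctx.Δ, ∃ k : ℤ, 1 ≤ k ∧ x = (α, (k : ℚ), 0)}

/-- the set `Π̂ = Π ∪ {α₀}` of affine simple roots -/
def SimpleHat : Set (V × ℚ × ℚ) :=
  {x | ∃ α ∈ ctx.simple, x = (α, (0 : ℚ), (0 : ℚ))} ∪ {ctx.alpha0}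

/-- the reflection `s_β : x ↦ x − (2(x,β)/(β,β))·β` in `V̂` -/
noncomputable def refl (β : V × ℚ × ℚ) : (V × ℚ × ℚ) ≃ₗ[ℚ] (V × ℚ × ℚ) :=
  if h : ctx.Bhat β β = 0 then LinearEquiv.refl ℚ _
  else
    Module.reflection (x := β) (f := (2 / ctx.Bhat β β) • ctx.Bhat β)
      (by simp only [LinearMap.smul_apply, smul_eq_mul]; field_simp)

/-- the affine Weyl group `Ŵ`, generated by the reflections `s_β`, `β ∈ Δ̂` -/
def What : Subgroup ((V × ℚ × ℚ) ≃ₗ[ℚ] (V × ℚ × ℚ)) :=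
  Subgroup.closure {g | ∃ β ∈ ctx.Δhat, g = ctx.refl β}

/-- the finite Weyl group `W`, generated by the reflections `s_α`, `α ∈ Δ`
(identified with a subgroup of `Ŵ`) -/
def Wfin : Subgroup ((V × ℚ × ℚ) ≃ₗ[ℚ] (V × ℚ × ℚ)) :=
  Subgroup.closure {g | ∃ α ∈ ctx.Δ, g = ctx.refl (α, (0 : ℚ), (0 : ℚ))}

/-- `N̂(w) = {β ∈ Δ̂⁺ : w(β) ∈ −Δ̂⁺}` -/
def Nhat (w : (V × ℚ × ℚ) ≃ₗ[ℚ] (V × ℚ × ℚ)) : Set (V × ℚ × ℚ) :=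
  {β | β ∈ ctx.PosHat ∧ -(w β) ∈ ctx.PosHat}

/-- a minuscule element of `Ŵ`: every element of `N̂(w)` has the form `δ - γ`
with `γ ∈ Δ⁺` -/
def IsMinuscule (w : (V × ℚ × ℚ) ≃ₗ[ℚ] (V × ℚ × ℚ)) : Prop :=
  w ∈ ctx.What ∧ ∀ β ∈ ctx.Nhat w, ∃ γ ∈ ctx.Pos, β = ctx.δhat - ctx.emb γ

/-- the abelian ideal `I_w` corresponding to a minuscule element `w` -/
def idealOf (w : (V × ℚ × ℚ) ≃ₗ[ℚ] (V × ℚ × ℚ)) : Set V :=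
  {γ | γ ∈ ctx.Pos ∧ ctx.δhat - ctx.emb γ ∈ ctx.Nhat w}

/-- the ideal `I` has rootlet `τ(I) = μ`, i.e. `I = I_w` for some minuscule `w`
with `w(α₀) + δ = μ` -/
def HasRootlet (I : Set V) (μ : V) : Prop :=
  ∃ w, ctx.IsMinuscule w ∧ ctx.idealOf w = I ∧ w ctx.alpha0 + ctx.δhat = ctx.emb μ

/-- `Ab_μ`, the set of nonempty abelian ideals with rootlet `μ` -/
def AbFiber (μ : V) : Set (Set V) := {I | I.Nonempty ∧ ctx.HasRootlet I μ}

/-- `N(u) = {γ ∈ Δ⁺ : u(γ) ∈ −Δ⁺}` for `u` in the finite Weyl group -/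
def Nfin (w : (V × ℚ × ℚ) ≃ₗ[ℚ] (V × ℚ × ℚ)) : Set V :=
  {γ | γ ∈ ctx.Pos ∧ -(w (ctx.emb γ)) ∈ ctx.PosHat}

/-- the length `l(u) = #N(u)` of an element of the finite Weyl group -/
noncomputable def lenFin (w : (V × ℚ × ℚ) ≃ₗ[ℚ] (V × ℚ × ℚ)) : ℕ :=
  (ctx.Nfin w).ncard

end RootSystemCtx

namespace RootSystemCtx

variable {V : Type*} [AddCommGroup V] [Module ℚ V] (ctx : RootSystemCtx V)

/-! ### Finite root systems -/

lemma mem_of_pos {α : V} (h : α ∈ ctx.Pos) : α ∈ ctx.Δ := ctx.pos_subset h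

lemma ne_zero_of_mem {α : V} (h : α ∈ ctx.Δ) : α ≠ 0 := fun h0 =>
  ctx.zero_notMem_Δ (h0 ▸ h)

lemma B_self_pos {α : V} (h : α ∈ ctx.Δ) : 0 < ctx.B α α :=
  ctx.B_posdef α (ctx.ne_zero_of_mem h)

lemma add_mem_of_B_neg {α β : V} (hα : α ∈ ctx.Δ) (hβ : β ∈ ctx.Δ) (h : ctx.B α β < 0)
    (hne : α + β ≠ 0) : α + β ∈ ctx.Δ := by
  have hαα := ctx.B_self_pos hα
  have hββ := ctx.B_self_pos hβ
  obtain ⟨n, hn⟩ := ctx.crystallographic α hα β hβ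
  obtain ⟨m, hm⟩ := ctx.crystallographic β hβ α hα
  have hsymm := ctx.B_symm β α
  have hn0 : n < 0 := by
    have : (n : ℚ) < 0 := by rw [← hn]; exact div_neg_of_neg_of_pos (by linarith) hββ
    exact_mod_cast this
  have hm0 : m < 0 := by
    have : (m : ℚ) < 0 := by rw [← hm]; exact div_neg_of_neg_of_pos (by linarith) hαα
    exact_mod_cast this
  by_cases hn1 : n = -1
  · have := ctx.reflect_mem β hβ α hα
    rw [hn, hn1] at this
    simpa using this
  by_cases hm1 : m = -1
  · have := ctx.reflect_mem α hα β hβ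
    rw [hm, hm1] at this
    simpa [add_comm] using this
  have hn2 : (n : ℚ) ≤ -2 := by exact_mod_cast (by omega : n ≤ -2)
  have hm2 : (m : ℚ) ≤ -2 := by exact_mod_cast (by omega : m ≤ -2)
  rw [← hn, div_le_iff₀ hββ] at hn2
  rw [← hm, div_le_iff₀ hαα] at hm2
  have := ctx.B_posdef _ hne
  simp only [map_add, LinearMap.add_apply] at this
  linarith

lemma sub_mem_of_B_pos {α β : V} (hα : α ∈ ctx.Δ) (hβ : β ∈ ctx.Δ) (h : 0 < ctx.B α β)
    (hne : α ≠ β) : α - β ∈ ctx.Δ := by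
  rw [sub_eq_add_neg]
  refine ctx.add_mem_of_B_neg hα (ctx.neg_mem_Δ _ hβ) (by simpa using h) ?_
  rwa [← sub_eq_add_neg, sub_ne_zero]

/-- A nonempty sum of positive roots is nonzero. -/
lemma multiset_sum_ne_zero (s : Multiset V) (hs : ∀ x ∈ s, x ∈ ctx.Pos) (h0 : s ≠ 0) :
    s.sum ≠ 0 := by
  induction hn : Multiset.card s using Nat.strong_induction_on generalizing s with
  | _ n ih =>
  intro hsum
  obtain ⟨a, ha⟩ := Multiset.exists_mem_of_ne_zero h0
  obtain ⟨t, rfl⟩ := Multiset.exists_cons_of_mem ha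
  have haP : a ∈ ctx.Pos := hs a ha
  obtain ⟨b, hb, hab⟩ : ∃ b ∈ t, ctx.B a b < 0 := by
    by_contra! hcon
    have h1 : 0 ≤ ctx.B a t.sum := by
      rw [map_multiset_sum]
      refine Multiset.sum_nonneg fun x hx => ?_
      obtain ⟨b, hb, rfl⟩ := Multiset.mem_map.1 hx
      exact hcon b hb
    have h2 : ctx.B a a + ctx.B a t.sum = 0 := by
      rw [← map_add, ← Multiset.sum_cons, hsum, map_zero]
    linarith [ctx.B_self_pos (ctx.mem_of_pos haP)]
  obtain ⟨r, rfl⟩ := Multiset.exists_cons_of_mem hb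
  have hbP : b ∈ ctx.Pos := hs b (by simp)
  have habP : a + b ∈ ctx.Pos := by
    refine ctx.add_pos_mem a haP b hbP (ctx.add_mem_of_B_neg (ctx.mem_of_pos haP)
      (ctx.mem_of_pos hbP) hab fun h => ?_)
    exact ctx.pos_not_neg a haP (by rwa [← eq_neg_of_add_eq_zero_right h])
  refine ih (Multiset.card ((a + b) ::ₘ r)) (by simp at hn ⊢; omega) ((a + b) ::ₘ r) ?_
    (Multiset.cons_ne_zero) rfl ?_
  · intro x hx
    rcases Multiset.mem_cons.1 hx with rfl | hx
    · exact habP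
    · exact hs x (by simp [hx])
  · simpa [add_assoc] using hsum

/-- The reflection of `β` in the hyperplane orthogonal to `α`. -/
def sref (α β : V) : V := β - (2 * ctx.B β α / ctx.B α α) • α

lemma sref_mem {α β : V} (hα : α ∈ ctx.Δ) (hβ : β ∈ ctx.Δ) : ctx.sref α β ∈ ctx.Δ :=
  ctx.reflect_mem α hα β hβ

lemma B_sref_left {α : V} (hα : α ∈ ctx.Δ) (β : V) :
    ctx.B (ctx.sref α β) α = -ctx.B β α := by
  have := (ctx.B_self_pos hα).ne'
  simp only [sref, map_sub, map_smul, LinearMap.sub_apply, LinearMap.smul_apply, smul_eq_mul]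
  field_simp
  ring

lemma sref_sref {α : V} (hα : α ∈ ctx.Δ) (β : V) : ctx.sref α (ctx.sref α β) = β := by
  rw [sref, ctx.B_sref_left hα, sref]
  module

lemma B_sref_self {α : V} (hα : α ∈ ctx.Δ) (β : V) :
    ctx.B (ctx.sref α β) (ctx.sref α β) = ctx.B β β := by
  have := (ctx.B_self_pos hα).ne'
  simp only [sref, map_sub, map_smul, LinearMap.sub_apply, LinearMap.smul_apply, smul_eq_mul,
    ctx.B_symm α β]
  field_simp
  ring

lemma sref_self {α : V} (hα : α ∈ ctx.Δ) : ctx.sref α α = -α := by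
  have := (ctx.B_self_pos hα).ne'
  rw [sref, mul_div_assoc, div_self this]
  module

/-- If a positive root is sent to a negative one by the reflection in the positive root `β`,
it has positive inner product with `β`. -/
lemma B_pos_of_sref_notMem {β γ : V} (hβ : β ∈ ctx.Pos) (hγ : γ ∈ ctx.Pos)
    (h : ctx.sref β γ ∉ ctx.Pos) : 0 < ctx.B γ β := by
  by_contra! hle
  have hββ := ctx.B_self_pos (ctx.mem_of_pos hβ)
  obtain ⟨n, hn⟩ := ctx.crystallographic γ (ctx.mem_of_pos hγ) β (ctx.mem_of_pos hβ)
  have hn0 : n ≤ 0 := by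
    have : (n : ℚ) ≤ 0 := by
      rw [← hn]; exact div_nonpos_of_nonpos_of_nonneg (by linarith) hββ.le
    exact_mod_cast this
  obtain ⟨m, rfl⟩ : ∃ m : ℕ, n = -(m : ℤ) := ⟨(-n).toNat, by omega⟩
  have hneg := (ctx.mem_pos_or_neg_pos _
    (ctx.sref_mem (ctx.mem_of_pos hβ) (ctx.mem_of_pos hγ))).resolve_left h
  refine ctx.multiset_sum_ne_zero (γ ::ₘ -(ctx.sref β γ) ::ₘ Multiset.replicate m β) ?_
    Multiset.cons_ne_zero ?_
  · intro x hx
    simp only [Multiset.mem_cons, Multiset.mem_replicate] at hx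
    rcases hx with rfl | rfl | ⟨-, rfl⟩ <;> assumption
  · simp only [Multiset.sum_cons, Multiset.sum_replicate, sref, hn]
    push_cast
    rw [← Nat.cast_smul_eq_nsmul ℚ]
    module

/-- The finite set of positive roots. -/
noncomputable def posFinset : Finset V := (ctx.Δ_finite.subset ctx.pos_subset).toFinset

lemma mem_posFinset {α : V} : α ∈ ctx.posFinset ↔ α ∈ ctx.Pos := by simp [posFinset]

/-- The height functional, i.e. the pairing with half the sum of the positive coroots. -/
noncomputable def ht : V →ₗ[ℚ] ℚ := ∑ γ ∈ ctx.posFinset, (1 / ctx.B γ γ) • ctx.B γ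

open Classical in
lemma ht_eq {β : V} (hβ : β ∈ ctx.Pos) :
    ctx.ht β = ∑ γ ∈ ctx.posFinset with ctx.sref β γ ∉ ctx.Pos, ctx.B γ β / ctx.B γ γ := by
  have hβΔ := ctx.mem_of_pos hβ
  have h0 : ∑ γ ∈ ctx.posFinset with ctx.sref β γ ∈ ctx.Pos, ctx.B γ β / ctx.B γ γ = 0 := by
    refine Finset.sum_involution (fun γ _ => ctx.sref β γ) ?_ ?_ ?_ ?_
    · intro γ _
      simp only [ctx.B_sref_self hβΔ, ctx.B_sref_left hβΔ]
      ring
    · intro γ _ hne heq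
      have := ctx.B_sref_left hβΔ γ
      rw [heq] at this
      exact hne (by rw [show ctx.B γ β = 0 by linarith, zero_div])
    · intro γ hγ
      simp only [Finset.mem_filter, mem_posFinset] at hγ ⊢
      exact ⟨hγ.2, by rw [ctx.sref_sref hβΔ]; exact hγ.1⟩
    · intro γ _
      exact ctx.sref_sref hβΔ γ
  have h1 := Finset.sum_filter_add_sum_filter_not ctx.posFinset
    (fun γ => ctx.sref β γ ∈ ctx.Pos) (fun γ => ctx.B γ β / ctx.B γ γ)
  rw [h0, zero_add] at h1
  rw [h1, ht, LinearMap.sum_apply]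
  refine Finset.sum_congr rfl fun γ _ => ?_
  simp only [LinearMap.smul_apply, smul_eq_mul]
  ring

lemma ht_pos {β : V} (hβ : β ∈ ctx.Pos) : 0 < ctx.ht β := by
  classical
  rw [ctx.ht_eq hβ]
  refine Finset.sum_pos (fun γ hγ => ?_) ⟨β, ?_⟩
  · simp only [Finset.mem_filter, mem_posFinset] at hγ
    exact div_pos (ctx.B_pos_of_sref_notMem hβ hγ.1 hγ.2) (ctx.B_self_pos (ctx.mem_of_pos hγ.1))
  · simp only [Finset.mem_filter, mem_posFinset, ctx.sref_self (ctx.mem_of_pos hβ)]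
    exact ⟨hβ, ctx.pos_not_neg β hβ⟩

lemma mem_simple_sub_pos {α β : V} (hα : α ∈ ctx.simple) (hβ : β ∈ ctx.Pos)
    (h : β - α ∈ ctx.Δ) : β - α ∈ ctx.Pos := by
  refine (ctx.mem_pos_or_neg_pos _ h).resolve_right fun hneg => hα.2 ⟨β, hβ, _, hneg, ?_⟩
  abel

/-- A simple reflection permutes the other positive roots. -/
lemma sref_simple_mem {α β : V} (hα : α ∈ ctx.simple) (hβ : β ∈ ctx.Pos) (hne : β ≠ α) :
    ctx.sref α β ∈ ctx.Pos := by
  have hαP := hα.1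
  have hαΔ := ctx.mem_of_pos hαP
  have hαα := ctx.B_self_pos hαΔ
  obtain ⟨n, hn⟩ := ctx.crystallographic β (ctx.mem_of_pos hβ) α hαΔ
  induction hm : n.toNat using Nat.strong_induction_on generalizing β n with
  | _ m ih =>
  by_contra hcon
  have hBpos := ctx.B_pos_of_sref_notMem hαP hβ hcon
  have hn0 : 0 < n := by
    have : (0 : ℚ) < n := by rw [← hn]; positivity
    exact_mod_cast this
  have hβα : β - α ∈ ctx.Pos := ctx.mem_simple_sub_pos hα hβ
    (ctx.sub_mem_of_B_pos (ctx.mem_of_pos hβ) hαΔ hBpos hne)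
  have hmem := ctx.sref_mem hαΔ (ctx.mem_of_pos hβ)
  by_cases hn1 : n = 1
  · rw [sref, hn, hn1] at hcon
    simp only [Int.cast_one, one_smul] at hcon
    exact hcon hβα
  have hne' : β - α ≠ α := by
    intro h
    have h2 : β = (2 : ℚ) • α := by rw [two_smul, ← sub_eq_iff_eq_add, h]
    rcases ctx.reduced α hαΔ 2 (h2 ▸ ctx.mem_of_pos hβ) with h | h <;> norm_num at h
  have hpair : 2 * ctx.B (β - α) α / ctx.B α α = ((n - 2 : ℤ) : ℚ) := by
    push_cast
    rw [← hn]
    simp only [map_sub, LinearMap.sub_apply]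
    field_simp
  have h1 := ih (n - 2).toNat (by omega) hβα hne' (n - 2) hpair rfl
  have heq : ctx.sref α β = ctx.sref α (β - α) - α := by
    rw [sref, sref, hpair, hn]
    push_cast
    module
  rw [heq] at hmem hcon
  exact hcon (ctx.mem_simple_sub_pos hα h1 hmem)

lemma ht_simple {α : V} (hα : α ∈ ctx.simple) : ctx.ht α = 1 := by
  classical
  have hαα := ctx.B_self_pos (ctx.mem_of_pos hα.1)
  rw [ctx.ht_eq hα.1, Finset.sum_eq_single α]
  · exact div_self hαα.ne'
  · intro γ hγ hne
    simp only [Finset.mem_filter, mem_posFinset] at hγ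
    exact absurd (ctx.sref_simple_mem hα hγ.1 hne) hγ.2
  · intro h
    refine absurd ?_ h
    simp only [Finset.mem_filter, mem_posFinset, ctx.sref_self (ctx.mem_of_pos hα.1)]
    exact ⟨hα.1, ctx.pos_not_neg α hα.1⟩

lemma pos_finite : ctx.Pos.Finite := ctx.Δ_finite.subset ctx.pos_subset

lemma pos_subset_closure_simple {β : V} (hβ : β ∈ ctx.Pos) :
    β ∈ AddSubmonoid.closure ctx.simple := by
  by_contra hcon
  obtain ⟨γ, ⟨hγ, hγc⟩, hmin⟩ := Set.exists_min_image
    {γ | γ ∈ ctx.Pos ∧ γ ∉ AddSubmonoid.closure ctx.simple} ctx.ht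
    (ctx.pos_finite.subset fun _ h => h.1) ⟨β, hβ, hcon⟩
  by_cases hs : γ ∈ ctx.simple
  · exact hγc (AddSubmonoid.subset_closure hs)
  · simp only [simple, Set.mem_ofPred_eq, not_and, not_not] at hs
    obtain ⟨μ, hμ, ν, hν, rfl⟩ := hs hγ
    have h1 := ctx.ht_pos hμ
    have h2 := ctx.ht_pos hν
    refine hγc (add_mem ?_ ?_) <;> by_contra hc
    · have := hmin μ ⟨hμ, hc⟩
      simp only [map_add] at this
      linarith
    · have := hmin ν ⟨hν, hc⟩
      simp only [map_add] at this
      linarith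

lemma closure_pos_le : AddSubmonoid.closure ctx.Pos ≤ AddSubmonoid.closure ctx.simple :=
  AddSubmonoid.closure_le.2 fun _ h => ctx.pos_subset_closure_simple h

lemma eq_zero_or_one_le_ht {y : V} (hy : y ∈ AddSubmonoid.closure ctx.Pos) :
    y = 0 ∨ 1 ≤ ctx.ht y := by
  replace hy := ctx.closure_pos_le hy
  induction hy using AddSubmonoid.closure_induction with
  | mem x hx => exact Or.inr (ctx.ht_simple hx).ge
  | zero => exact Or.inl rfl
  | add x y _ _ hx hy =>
    rcases hx with rfl | hx
    · simpa using hy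
    rcases hy with rfl | hy
    · simpa using Or.inr hx
    · right; rw [map_add]; linarith

lemma ht_nonneg {y : V} (hy : y ∈ AddSubmonoid.closure ctx.Pos) : 0 ≤ ctx.ht y := by
  rcases ctx.eq_zero_or_one_le_ht hy with rfl | h
  · simp
  · linarith

lemma one_le_ht {β : V} (hβ : β ∈ ctx.Pos) : 1 ≤ ctx.ht β :=
  (ctx.eq_zero_or_one_le_ht (AddSubmonoid.subset_closure hβ)).resolve_left
    (ctx.ne_zero_of_mem (ctx.mem_of_pos hβ))

lemma θ_mem : ctx.θ ∈ ctx.Δ := ctx.mem_of_pos ctx.θ_pos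

lemma ht_le_θ {ν : V} (hν : ν ∈ ctx.Δ) : ctx.ht ν ≤ ctx.ht ctx.θ := by
  have := ctx.ht_nonneg (ctx.θ_highest ν hν)
  rw [map_sub] at this
  linarith

lemma eq_θ_of_ht_le {ν : V} (hν : ν ∈ ctx.Δ) (h : ctx.ht ctx.θ ≤ ctx.ht ν) : ν = ctx.θ := by
  rcases ctx.eq_zero_or_one_le_ht (ctx.θ_highest ν hν) with h0 | h1
  · exact (sub_eq_zero.1 h0).symm
  · rw [map_sub] at h1
    linarith

lemma B_θ_nonneg {γ : V} (hγ : γ ∈ ctx.Pos) : 0 ≤ ctx.B γ ctx.θ := by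
  by_contra! h
  have h1 := ctx.ht_pos hγ
  have h2 := ctx.ht_pos ctx.θ_pos
  have hne : γ + ctx.θ ≠ 0 := by
    intro h0
    have := congrArg ctx.ht h0
    rw [map_add, map_zero] at this
    linarith
  have := ctx.ht_le_θ (ctx.add_mem_of_B_neg (ctx.mem_of_pos hγ) ctx.θ_mem h hne)
  rw [map_add] at this
  linarith

lemma two_mul_B_θ {γ : V} (hγ : γ ∈ ctx.Pos) (hne : γ ≠ ctx.θ) (h : ctx.B γ ctx.θ ≠ 0) :
    2 * ctx.B γ ctx.θ = ctx.B ctx.θ ctx.θ := by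
  have hpos : 0 < ctx.B γ ctx.θ := lt_of_le_of_ne (ctx.B_θ_nonneg hγ) h.symm
  have hθθ := ctx.B_self_pos ctx.θ_mem
  obtain ⟨n, hn⟩ := ctx.crystallographic γ (ctx.mem_of_pos hγ) ctx.θ ctx.θ_mem
  have hn0 : 0 < n := by
    have : (0 : ℚ) < n := by rw [← hn]; positivity
    exact_mod_cast this
  have hn1 : n = 1 := by
    by_contra hn1
    have hn2 : (2 : ℚ) ≤ n := by exact_mod_cast (by omega : 2 ≤ n)
    have h1 := ctx.ht_le_θ (ctx.neg_mem_Δ _ (ctx.sref_mem ctx.θ_mem (ctx.mem_of_pos hγ)))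
    have h2 := ctx.ht_pos ctx.θ_pos
    simp only [sref, hn, map_neg, map_sub, map_smul, smul_eq_mul] at h1
    exact hne (ctx.eq_θ_of_ht_le (ctx.mem_of_pos hγ) (by nlinarith))
  rw [hn1, Int.cast_one, div_eq_one_iff_eq hθθ.ne'] at hn
  exact hn

lemma exists_simple_B_neg {μ : V} (hμ : μ ∈ ctx.Pos)
    (hlong : ctx.B μ μ = ctx.B ctx.θ ctx.θ) (hne : μ ≠ ctx.θ) :
    ∃ α ∈ ctx.simple, ctx.B α μ < 0 := by
  by_contra! hcon
  have hdom : ∀ y ∈ AddSubmonoid.closure ctx.simple, 0 ≤ ctx.B y μ := by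
    intro y hy
    induction hy using AddSubmonoid.closure_induction with
    | mem x hx => exact hcon x hx
    | zero => simp
    | add x y _ _ hx hy => simp only [map_add, LinearMap.add_apply]; linarith
  have h1 := hdom _ (ctx.closure_pos_le (ctx.θ_highest μ (ctx.mem_of_pos hμ)))
  have h2 := ctx.B_posdef (ctx.θ - μ) (sub_ne_zero.2 hne.symm)
  simp only [map_sub, LinearMap.sub_apply, ctx.B_symm μ ctx.θ] at h1 h2
  linarith

/-! ### Affine roots and their heights -/

lemma Bhat_apply (x y : V × ℚ × ℚ) :
    ctx.Bhat x y = ctx.B x.1 y.1 + x.2.1 * y.2.2 + x.2.2 * y.2.1 := rfl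

lemma Bhat_symm (x y : V × ℚ × ℚ) : ctx.Bhat x y = ctx.Bhat y x := by
  rw [Bhat_apply, Bhat_apply, ctx.B_symm]
  ring

lemma Bhat_self_pos {x : V × ℚ × ℚ} (hx : x ∈ ctx.Δhat) : 0 < ctx.Bhat x x := by
  obtain ⟨α, hα, k, rfl⟩ := hx
  simpa [Bhat_apply] using ctx.B_self_pos hα

lemma mk_mem_Δhat {α : V} (hα : α ∈ ctx.Δ) (k : ℤ) : (α, (k : ℚ), (0 : ℚ)) ∈ ctx.Δhat :=
  ⟨α, hα, k, rfl⟩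

lemma emb_mem_Δhat {α : V} (hα : α ∈ ctx.Δ) : ctx.emb α ∈ ctx.Δhat :=
  ⟨α, hα, 0, by simp [emb]⟩

lemma neg_mem_Δhat {x : V × ℚ × ℚ} (hx : x ∈ ctx.Δhat) : -x ∈ ctx.Δhat := by
  obtain ⟨α, hα, k, rfl⟩ := hx
  exact ⟨-α, ctx.neg_mem_Δ α hα, -k, by simp⟩

lemma refl_apply {β : V × ℚ × ℚ} (hβ : β ∈ ctx.Δhat) (x : V × ℚ × ℚ) :
    ctx.refl β x = x - (2 * ctx.Bhat β x / ctx.Bhat β β) • β := by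
  rw [refl, dif_neg (ctx.Bhat_self_pos hβ).ne', Module.reflection_apply]
  simp only [LinearMap.smul_apply, smul_eq_mul]
  ring_nf

lemma refl_self {β : V × ℚ × ℚ} (hβ : β ∈ ctx.Δhat) : ctx.refl β β = -β := by
  rw [ctx.refl_apply hβ, mul_div_assoc, div_self (ctx.Bhat_self_pos hβ).ne']
  module

lemma Bhat_refl_right {β : V × ℚ × ℚ} (hβ : β ∈ ctx.Δhat) (x : V × ℚ × ℚ) :
    ctx.Bhat β (ctx.refl β x) = -ctx.Bhat β x := by
  have := (ctx.Bhat_self_pos hβ).ne'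
  rw [ctx.refl_apply hβ, map_sub, map_smul, smul_eq_mul]
  field_simp
  ring

lemma refl_refl {β : V × ℚ × ℚ} (hβ : β ∈ ctx.Δhat) (x : V × ℚ × ℚ) :
    ctx.refl β (ctx.refl β x) = x := by
  rw [ctx.refl_apply hβ (ctx.refl β x), ctx.Bhat_refl_right hβ, ctx.refl_apply hβ x]
  module

lemma Bhat_refl_refl {β : V × ℚ × ℚ} (hβ : β ∈ ctx.Δhat) (x y : V × ℚ × ℚ) :
    ctx.Bhat (ctx.refl β x) (ctx.refl β y) = ctx.Bhat x y := by
  have := (ctx.Bhat_self_pos hβ).ne'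
  rw [ctx.refl_apply hβ x, map_sub, LinearMap.sub_apply, map_smul, LinearMap.smul_apply,
    ctx.Bhat_refl_right hβ, ctx.refl_apply hβ y, map_sub, map_smul, ctx.Bhat_symm x β]
  simp only [smul_eq_mul]
  field_simp
  ring

lemma refl_eq_of_Bhat_eq_zero {β x : V × ℚ × ℚ} (hβ : β ∈ ctx.Δhat) (h : ctx.Bhat β x = 0) :
    ctx.refl β x = x := by
  simp [ctx.refl_apply hβ, h]

lemma refl_mk {α : V} (hα : α ∈ ctx.Δ) (k : ℤ) (γ : V) (l : ℚ) :
    ctx.refl (α, (k : ℚ), 0) (γ, l, 0) =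
      (ctx.sref α γ, l - 2 * ctx.B γ α / ctx.B α α * k, 0) := by
  rw [ctx.refl_apply (ctx.mk_mem_Δhat hα k)]
  simp [Bhat_apply, sref, ctx.B_symm γ α]

lemma refl_mem_Δhat {β x : V × ℚ × ℚ} (hβ : β ∈ ctx.Δhat) (hx : x ∈ ctx.Δhat) :
    ctx.refl β x ∈ ctx.Δhat := by
  obtain ⟨α, hα, k, rfl⟩ := hβ
  obtain ⟨γ, hγ, l, rfl⟩ := hx
  obtain ⟨n, hn⟩ := ctx.crystallographic γ hγ α hα
  refine ⟨ctx.sref α γ, ctx.sref_mem hα hγ, l - n * k, ?_⟩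
  rw [ctx.refl_mk hα, hn]
  push_cast
  rfl

/-- The affine height functional, equal to one on all affine simple roots. -/
noncomputable def htHat : V × ℚ × ℚ →ₗ[ℚ] ℚ :=
  ctx.ht ∘ₗ LinearMap.fst ℚ V (ℚ × ℚ) +
    (ctx.ht ctx.θ + 1) • (LinearMap.fst ℚ ℚ ℚ ∘ₗ LinearMap.snd ℚ V (ℚ × ℚ))

lemma htHat_apply (x : V × ℚ × ℚ) :
    ctx.htHat x = ctx.ht x.1 + (ctx.ht ctx.θ + 1) * x.2.1 := by
  simp [htHat]

lemma emb_mem_PosHat {α : V} (hα : α ∈ ctx.Pos) : ctx.emb α ∈ ctx.PosHat :=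
  Or.inl ⟨α, hα, rfl⟩

lemma mk_mem_PosHat {α : V} (hα : α ∈ ctx.Δ) {k : ℤ} (hk : 1 ≤ k) :
    (α, (k : ℚ), (0 : ℚ)) ∈ ctx.PosHat :=
  Or.inr ⟨α, hα, k, hk, rfl⟩

lemma PosHat_subset {x : V × ℚ × ℚ} (hx : x ∈ ctx.PosHat) : x ∈ ctx.Δhat := by
  rcases hx with ⟨α, hα, rfl⟩ | ⟨α, hα, k, -, rfl⟩
  · exact ctx.emb_mem_Δhat (ctx.mem_of_pos hα)
  · exact ctx.mk_mem_Δhat hα k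

lemma one_le_htHat {x : V × ℚ × ℚ} (hx : x ∈ ctx.PosHat) : 1 ≤ ctx.htHat x := by
  rw [htHat_apply]
  rcases hx with ⟨α, hα, rfl⟩ | ⟨α, hα, k, hk, rfl⟩
  · simpa using ctx.one_le_ht hα
  · have h1 := ctx.ht_le_θ (ctx.neg_mem_Δ α hα)
    have h2 := ctx.ht_pos ctx.θ_pos
    have hk' : (1 : ℚ) ≤ k := by exact_mod_cast hk
    rw [map_neg] at h1
    simp only
    nlinarith

lemma mem_or_neg_mem_PosHat {x : V × ℚ × ℚ} (hx : x ∈ ctx.Δhat) :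
    x ∈ ctx.PosHat ∨ -x ∈ ctx.PosHat := by
  obtain ⟨α, hα, k, rfl⟩ := hx
  rcases lt_trichotomy k 0 with hk | rfl | hk
  · right
    exact Or.inr ⟨-α, ctx.neg_mem_Δ α hα, -k, by omega, by simp⟩
  · rcases ctx.mem_pos_or_neg_pos α hα with h | h
    · exact Or.inl (Or.inl ⟨α, h, by simp⟩)
    · exact Or.inr (Or.inl ⟨-α, h, by simp⟩)
  · exact Or.inl (ctx.mk_mem_PosHat hα hk)

lemma mem_PosHat_of_htHat_pos {x : V × ℚ × ℚ} (hx : x ∈ ctx.Δhat) (h : 0 < ctx.htHat x) :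
    x ∈ ctx.PosHat := by
  refine (ctx.mem_or_neg_mem_PosHat hx).resolve_right fun hneg => ?_
  have := ctx.one_le_htHat hneg
  rw [map_neg] at this
  linarith

lemma neg_mem_PosHat_of_notMem {x : V × ℚ × ℚ} (hx : x ∈ ctx.Δhat) (h : x ∉ ctx.PosHat) :
    -x ∈ ctx.PosHat :=
  (ctx.mem_or_neg_mem_PosHat hx).resolve_left h

lemma neg_notMem_PosHat {x : V × ℚ × ℚ} (hx : x ∈ ctx.PosHat) : -x ∉ ctx.PosHat := by
  intro hneg
  have h1 := ctx.one_le_htHat hx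
  have h2 := ctx.one_le_htHat hneg
  rw [map_neg] at h2
  linarith

lemma mk_zero_mem_PosHat {α : V} : (α, (0 : ℚ), (0 : ℚ)) ∈ ctx.PosHat ↔ α ∈ ctx.Pos := by
  refine ⟨?_, fun h => ctx.emb_mem_PosHat h⟩
  rintro (⟨β, hβ, h⟩ | ⟨β, hβ, k, hk, h⟩)
  · simp only [Prod.mk.injEq] at h
    exact h.1 ▸ hβ
  · simp only [Prod.mk.injEq] at h
    have : k = 0 := by exact_mod_cast h.2.1.symm
    omega

lemma level_nonneg {α : V} {k : ℤ} (h : (α, (k : ℚ), (0 : ℚ)) ∈ ctx.PosHat) : 0 ≤ k := by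
  rcases h with ⟨β, hβ, h⟩ | ⟨β, hβ, l, hl, h⟩ <;> simp only [Prod.mk.injEq] at h
  · exact le_of_eq (by exact_mod_cast h.2.1.symm)
  · have : k = l := by exact_mod_cast h.2.1
    omega

lemma alpha0_eq : ctx.alpha0 = (-ctx.θ, ((1 : ℤ) : ℚ), 0) := by simp [alpha0]

lemma SimpleHat_subset {β : V × ℚ × ℚ} (hβ : β ∈ ctx.SimpleHat) : β ∈ ctx.PosHat := by
  rcases hβ with ⟨α, hα, rfl⟩ | rfl
  · exact ctx.emb_mem_PosHat hα.1
  · rw [alpha0_eq]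
    exact ctx.mk_mem_PosHat (ctx.neg_mem_Δ _ ctx.θ_mem) le_rfl

lemma SimpleHat_mem_Δhat {β : V × ℚ × ℚ} (hβ : β ∈ ctx.SimpleHat) : β ∈ ctx.Δhat :=
  ctx.PosHat_subset (ctx.SimpleHat_subset hβ)

lemma emb_mem_SimpleHat {α : V} (hα : α ∈ ctx.simple) : ctx.emb α ∈ ctx.SimpleHat :=
  Or.inl ⟨α, hα, rfl⟩

lemma alpha0_mem_SimpleHat : ctx.alpha0 ∈ ctx.SimpleHat := Or.inr rfl

lemma htHat_simple {β : V × ℚ × ℚ} (hβ : β ∈ ctx.SimpleHat) : ctx.htHat β = 1 := by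
  rw [htHat_apply]
  rcases hβ with ⟨α, hα, rfl⟩ | rfl
  · simpa using ctx.ht_simple hα
  · simp [alpha0]

lemma refl_alpha0_mk (γ : V) (l : ℚ) :
    ctx.refl ctx.alpha0 (γ, l, 0) =
      (ctx.sref ctx.θ γ, l + 2 * ctx.B γ ctx.θ / ctx.B ctx.θ ctx.θ, 0) := by
  rw [alpha0_eq, ctx.refl_mk (ctx.neg_mem_Δ _ ctx.θ_mem)]
  simp only [sref, map_neg, LinearMap.neg_apply, neg_neg, Int.cast_one, Prod.mk.injEq, and_true]
  constructor
  · simp only [mul_neg, neg_div, neg_smul_neg]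
  · ring

lemma sref_θ_of_pos {γ : V} (hγ : γ ∈ ctx.Pos) :
    (ctx.B γ ctx.θ = 0 ∧ ctx.sref ctx.θ γ = γ) ∨ γ = ctx.θ ∨
      (2 * ctx.B γ ctx.θ / ctx.B ctx.θ ctx.θ = 1 ∧ ctx.sref ctx.θ γ = γ - ctx.θ) := by
  by_cases h0 : ctx.B γ ctx.θ = 0
  · exact Or.inl ⟨h0, by simp [sref, h0]⟩
  by_cases h1 : γ = ctx.θ
  · exact Or.inr (Or.inl h1)
  have h2 : 2 * ctx.B γ ctx.θ / ctx.B ctx.θ ctx.θ = 1 := by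
    rw [ctx.two_mul_B_θ hγ h1 h0, div_self (ctx.B_self_pos ctx.θ_mem).ne']
  exact Or.inr (Or.inr ⟨h2, by rw [sref, h2, one_smul]⟩)

lemma refl_alpha0_mem {x : V × ℚ × ℚ} (hx : x ∈ ctx.PosHat) (hne : x ≠ ctx.alpha0) :
    ctx.refl ctx.alpha0 x ∈ ctx.PosHat := by
  have hmem := ctx.refl_mem_Δhat (ctx.SimpleHat_mem_Δhat ctx.alpha0_mem_SimpleHat)
    (ctx.PosHat_subset hx)
  have hθθ := ctx.B_self_pos ctx.θ_mem
  refine ctx.mem_PosHat_of_htHat_pos hmem ?_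
  have hθ := ctx.ht_pos ctx.θ_pos
  rcases hx with ⟨γ, hγ, rfl⟩ | ⟨γ, hγ, k, hk, rfl⟩
  · have hγ0 := ctx.ht_pos hγ
    rw [refl_alpha0_mk, htHat_apply]
    rcases ctx.sref_θ_of_pos hγ with ⟨h1, h2⟩ | rfl | ⟨h1, h2⟩
    · simpa [h1, h2] using hγ0
    · rw [ctx.sref_self ctx.θ_mem, mul_div_assoc, div_self hθθ.ne']
      simp only [map_neg]
      linarith
    · rw [h1, h2, map_sub]
      simp only
      linarith
  · have hk' : (1 : ℚ) ≤ k := by exact_mod_cast hk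
    rcases ctx.mem_pos_or_neg_pos γ hγ with hγP | hγN
    · have hB := ctx.B_θ_nonneg hγP
      have hpair : 0 ≤ 2 * ctx.B γ ctx.θ / ctx.B ctx.θ ctx.θ := by positivity
      rw [refl_alpha0_mk, htHat_apply]
      have h1 := ctx.ht_le_θ (ctx.neg_mem_Δ _ (ctx.sref_mem ctx.θ_mem hγ))
      rw [map_neg] at h1
      simp only
      nlinarith
    · obtain ⟨γ, rfl⟩ : ∃ ν, γ = -ν := ⟨-γ, by simp⟩
      rw [neg_neg] at hγN
      have hγ0 := ctx.ht_pos hγN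
      have hneg : ctx.sref ctx.θ (-γ) = -ctx.sref ctx.θ γ := by
        simp only [sref, map_neg, LinearMap.neg_apply]
        module
      rw [refl_alpha0_mk, htHat_apply, hneg]
      have hle := ctx.ht_le_θ (ctx.mem_of_pos hγN)
      simp only [map_neg, LinearMap.neg_apply, mul_neg, neg_div]
      rcases ctx.sref_θ_of_pos hγN with ⟨h1, h2⟩ | rfl | ⟨h1, h2⟩
      · rw [h1, h2]
        simp only [mul_zero, zero_div, neg_zero, add_zero]
        nlinarith
      · have hk2 : (2 : ℚ) ≤ k := by
          have : k ≠ 1 := by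
            rintro rfl
            exact hne ctx.alpha0_eq.symm
          exact_mod_cast (by omega : 2 ≤ k)
        rw [ctx.sref_self ctx.θ_mem, mul_div_assoc, div_self hθθ.ne', map_neg]
        nlinarith
      · rw [h1, h2, map_sub]
        have hlt : ctx.ht γ < ctx.ht ctx.θ := by
          by_contra! hge
          have := ctx.eq_θ_of_ht_le (ctx.mem_of_pos hγN) hge
          subst this
          rw [mul_div_assoc, div_self hθθ.ne'] at h1
          norm_num at h1
        nlinarith

/-- An affine simple reflection permutes the other positive affine roots. -/
lemma refl_simple_mem {β x : V × ℚ × ℚ} (hβ : β ∈ ctx.SimpleHat) (hx : x ∈ ctx.PosHat)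
    (hne : x ≠ β) : ctx.refl β x ∈ ctx.PosHat := by
  rcases hβ with ⟨α, hα, rfl⟩ | rfl
  · have h0 : ∀ γ (l : ℚ), ctx.refl (α, 0, 0) (γ, l, 0) = (ctx.sref α γ, l, 0) := by
      intro γ l
      simpa using ctx.refl_mk (ctx.mem_of_pos hα.1) 0 γ l
    rcases hx with ⟨γ, hγ, rfl⟩ | ⟨γ, hγ, k, hk, rfl⟩
    · rw [h0, mk_zero_mem_PosHat]
      refine ctx.sref_simple_mem hα hγ ?_
      rintro rfl
      exact hne rfl
    · rw [h0]
      exact ctx.mk_mem_PosHat (ctx.sref_mem (ctx.mem_of_pos hα.1) hγ) hk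
  · exact ctx.refl_alpha0_mem hx hne

lemma Bhat_simple_nonpos {β β' : V × ℚ × ℚ} (hβ : β ∈ ctx.SimpleHat) (hβ' : β' ∈ ctx.SimpleHat)
    (hne : β' ≠ β) : ctx.Bhat β β' ≤ 0 := by
  have h := ctx.one_le_htHat (ctx.refl_simple_mem hβ (ctx.SimpleHat_subset hβ') hne)
  rw [ctx.refl_apply (ctx.SimpleHat_mem_Δhat hβ), map_sub, map_smul, ctx.htHat_simple hβ,
    ctx.htHat_simple hβ', smul_eq_mul, mul_one] at h
  by_contra! hpos
  have := ctx.Bhat_self_pos (ctx.SimpleHat_mem_Δhat hβ)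
  have : 0 < 2 * ctx.Bhat β β' / ctx.Bhat β β := by positivity
  linarith

lemma emb_mem_closure_SimpleHat {y : V} (hy : y ∈ AddSubmonoid.closure ctx.Pos) :
    (y, (0 : ℚ), (0 : ℚ)) ∈ AddSubmonoid.closure ctx.SimpleHat := by
  replace hy := ctx.closure_pos_le hy
  induction hy using AddSubmonoid.closure_induction with
  | mem x hx => exact AddSubmonoid.subset_closure (ctx.emb_mem_SimpleHat hx)
  | zero => exact zero_mem _
  | add x y _ _ hx hy => simpa using add_mem hx hy

lemma δhat_mem_closure_SimpleHat : ctx.δhat ∈ AddSubmonoid.closure ctx.SimpleHat := by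
  have := add_mem (AddSubmonoid.subset_closure ctx.alpha0_mem_SimpleHat)
    (ctx.emb_mem_closure_SimpleHat (AddSubmonoid.subset_closure ctx.θ_pos))
  simpa [alpha0, δhat] using this

lemma PosHat_subset_closure_SimpleHat {x : V × ℚ × ℚ} (hx : x ∈ ctx.PosHat) :
    x ∈ AddSubmonoid.closure ctx.SimpleHat := by
  rcases hx with ⟨γ, hγ, rfl⟩ | ⟨γ, hγ, k, hk, rfl⟩
  · exact ctx.emb_mem_closure_SimpleHat (AddSubmonoid.subset_closure hγ)
  · obtain ⟨n, rfl⟩ : ∃ n : ℕ, k = n + 1 := ⟨(k - 1).toNat, by omega⟩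
    have h1 := ctx.emb_mem_closure_SimpleHat (ctx.θ_highest _ (ctx.neg_mem_Δ γ hγ))
    have h2 := nsmul_mem ctx.δhat_mem_closure_SimpleHat n
    have h3 : ctx.alpha0 ∈ _ := AddSubmonoid.subset_closure ctx.alpha0_mem_SimpleHat
    convert add_mem (add_mem h1 h2) h3 using 1
    simp [δhat, alpha0]

lemma exists_htHat_eq_natCast {x : V × ℚ × ℚ} (hx : x ∈ ctx.PosHat) :
    ∃ n : ℕ, ctx.htHat x = n := by
  have := ctx.PosHat_subset_closure_SimpleHat hx
  clear hx
  induction this using AddSubmonoid.closure_induction with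
  | mem x hx => exact ⟨1, by simpa using ctx.htHat_simple hx⟩
  | zero => exact ⟨0, by simp⟩
  | add x y _ _ hx hy =>
    obtain ⟨a, ha⟩ := hx
    obtain ⟨b, hb⟩ := hy
    exact ⟨a + b, by simp [ha, hb]⟩

lemma exists_simple_Bhat_pos {x : V × ℚ × ℚ} (hx : x ∈ ctx.PosHat) :
    ∃ β ∈ ctx.SimpleHat, 0 < ctx.Bhat β x := by
  by_contra! hcon
  have h : ∀ y ∈ AddSubmonoid.closure ctx.SimpleHat, ctx.Bhat y x ≤ 0 := by
    intro y hy
    induction hy using AddSubmonoid.closure_induction with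
    | mem y hy => exact hcon y hy
    | zero => simp
    | add y z _ _ hy hz => simp only [map_add, LinearMap.add_apply]; linarith
  exact (ctx.Bhat_self_pos (ctx.PosHat_subset hx)).not_ge
    (h x (ctx.PosHat_subset_closure_SimpleHat hx))

/-! ### The affine Weyl group -/

lemma refl_mem_What {β : V × ℚ × ℚ} (hβ : β ∈ ctx.Δhat) : ctx.refl β ∈ ctx.What :=
  Subgroup.subset_closure ⟨β, hβ, rfl⟩

lemma refl_mul_self {β : V × ℚ × ℚ} (hβ : β ∈ ctx.Δhat) : ctx.refl β * ctx.refl β = 1 :=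
  LinearEquiv.ext fun x => ctx.refl_refl hβ x

lemma refl_inv {β : V × ℚ × ℚ} (hβ : β ∈ ctx.Δhat) : (ctx.refl β)⁻¹ = ctx.refl β :=
  inv_eq_of_mul_eq_one_left (ctx.refl_mul_self hβ)

lemma inv_apply_apply (w : (V × ℚ × ℚ) ≃ₗ[ℚ] (V × ℚ × ℚ)) (x : V × ℚ × ℚ) :
    w⁻¹ (w x) = x := w.symm_apply_apply x

lemma apply_inv_apply (w : (V × ℚ × ℚ) ≃ₗ[ℚ] (V × ℚ × ℚ)) (x : V × ℚ × ℚ) :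
    w (w⁻¹ x) = x := w.apply_symm_apply x

lemma Bhat_What {w : (V × ℚ × ℚ) ≃ₗ[ℚ] (V × ℚ × ℚ)} (hw : w ∈ ctx.What) (x y : V × ℚ × ℚ) :
    ctx.Bhat (w x) (w y) = ctx.Bhat x y := by
  induction hw using Subgroup.closure_induction generalizing x y with
  | mem g hg =>
    obtain ⟨β, hβ, rfl⟩ := hg
    exact ctx.Bhat_refl_refl hβ x y
  | one => rfl
  | mul g h _ _ hg hh => rw [LinearEquiv.mul_apply, LinearEquiv.mul_apply, hg, hh]
  | inv g _ hg => rw [← hg, apply_inv_apply, apply_inv_apply]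

lemma δhat_What {w : (V × ℚ × ℚ) ≃ₗ[ℚ] (V × ℚ × ℚ)} (hw : w ∈ ctx.What) :
    w ctx.δhat = ctx.δhat := by
  induction hw using Subgroup.closure_induction with
  | mem g hg =>
    obtain ⟨β, hβ, rfl⟩ := hg
    refine ctx.refl_eq_of_Bhat_eq_zero hβ ?_
    obtain ⟨α, hα, k, rfl⟩ := hβ
    simp [Bhat_apply, δhat]
  | one => rfl
  | mul g h _ _ hg hh => rw [LinearEquiv.mul_apply, hh, hg]
  | inv g _ hg => nth_rewrite 1 [← hg]; exact inv_apply_apply g _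

lemma What_mem_Δhat_iff {w : (V × ℚ × ℚ) ≃ₗ[ℚ] (V × ℚ × ℚ)} (hw : w ∈ ctx.What)
    (x : V × ℚ × ℚ) : w x ∈ ctx.Δhat ↔ x ∈ ctx.Δhat := by
  induction hw using Subgroup.closure_induction generalizing x with
  | mem g hg =>
    obtain ⟨β, hβ, rfl⟩ := hg
    refine ⟨fun h => ?_, ctx.refl_mem_Δhat hβ⟩
    have := ctx.refl_mem_Δhat hβ h
    rwa [ctx.refl_refl hβ] at this
  | one => rfl
  | mul g h _ _ hg hh => rw [LinearEquiv.mul_apply, hg, hh]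
  | inv g _ hg => rw [← hg, apply_inv_apply]

lemma What_mem_Δhat {w : (V × ℚ × ℚ) ≃ₗ[ℚ] (V × ℚ × ℚ)} (hw : w ∈ ctx.What)
    {x : V × ℚ × ℚ} (hx : x ∈ ctx.Δhat) : w x ∈ ctx.Δhat :=
  (ctx.What_mem_Δhat_iff hw x).2 hx

lemma conj_refl {w : (V × ℚ × ℚ) ≃ₗ[ℚ] (V × ℚ × ℚ)} (hw : w ∈ ctx.What)
    {β : V × ℚ × ℚ} (hβ : β ∈ ctx.Δhat) :
    w * ctx.refl β * w⁻¹ = ctx.refl (w β) := by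
  refine LinearEquiv.ext fun x => ?_
  rw [LinearEquiv.mul_apply, LinearEquiv.mul_apply, ctx.refl_apply hβ,
    ctx.refl_apply (ctx.What_mem_Δhat hw hβ), map_sub, map_smul, apply_inv_apply,
    ctx.Bhat_What hw β β, ← ctx.Bhat_What hw β (w⁻¹ x), apply_inv_apply]

lemma refl_neg {β : V × ℚ × ℚ} (hβ : β ∈ ctx.Δhat) : ctx.refl (-β) = ctx.refl β := by
  refine LinearEquiv.ext fun x => ?_
  rw [ctx.refl_apply hβ, ctx.refl_apply (ctx.neg_mem_Δhat hβ)]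
  simp only [map_neg, LinearMap.neg_apply, neg_neg, mul_neg, neg_div, neg_smul_neg]

lemma refl_mem_closure_simple {x : V × ℚ × ℚ} (hx : x ∈ ctx.PosHat) :
    ctx.refl x ∈ Subgroup.closure (ctx.refl '' ctx.SimpleHat) := by
  obtain ⟨n, hn⟩ := ctx.exists_htHat_eq_natCast hx
  induction n using Nat.strong_induction_on generalizing x with
  | _ n ih =>
  obtain ⟨β, hβ, hpos⟩ := ctx.exists_simple_Bhat_pos hx
  have hβΔ := ctx.SimpleHat_mem_Δhat hβ
  have hββ := ctx.Bhat_self_pos hβΔ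
  have hβmem := Subgroup.subset_closure (Set.mem_image_of_mem ctx.refl hβ)
  by_cases hxβ : x = β
  · exact hxβ ▸ hβmem
  have hy := ctx.refl_simple_mem hβ hx hxβ
  obtain ⟨m, hm⟩ := ctx.exists_htHat_eq_natCast hy
  have hmn : m < n := by
    have : ctx.htHat (ctx.refl β x) < ctx.htHat x := by
      rw [ctx.refl_apply hβΔ, map_sub, map_smul, ctx.htHat_simple hβ, smul_eq_mul, mul_one]
      have : 0 < 2 * ctx.Bhat β x / ctx.Bhat β β := by positivity
      linarith
    rw [hm, hn] at this
    exact_mod_cast this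
  have h1 := ctx.conj_refl (ctx.refl_mem_What hβΔ) (ctx.PosHat_subset hy)
  rw [ctx.refl_refl hβΔ] at h1
  rw [← h1]
  exact mul_mem (mul_mem hβmem (ih m hmn hy hm)) (inv_mem hβmem)

lemma What_eq_closure_simple : ctx.What = Subgroup.closure (ctx.refl '' ctx.SimpleHat) := by
  refine le_antisymm ((Subgroup.closure_le _).2 ?_) ((Subgroup.closure_le _).2 ?_)
  · rintro _ ⟨β, hβ, rfl⟩
    rcases ctx.mem_or_neg_mem_PosHat hβ with h | h
    · exact ctx.refl_mem_closure_simple h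
    · rw [← ctx.refl_neg hβ]
      exact ctx.refl_mem_closure_simple h
  · rintro _ ⟨β, hβ, rfl⟩
    exact ctx.refl_mem_What (ctx.SimpleHat_mem_Δhat hβ)

lemma exists_simple_list {w : (V × ℚ × ℚ) ≃ₗ[ℚ] (V × ℚ × ℚ)} (hw : w ∈ ctx.What) :
    ∃ L : List (V × ℚ × ℚ), (∀ β ∈ L, β ∈ ctx.SimpleHat) ∧ w = (L.map ctx.refl).prod := by
  rw [What_eq_closure_simple] at hw
  induction hw using Subgroup.closure_induction with
  | mem g hg =>
    obtain ⟨β, hβ, rfl⟩ := hg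
    exact ⟨[β], by simpa using hβ, by simp⟩
  | one => exact ⟨[], by simp, by simp⟩
  | mul g h _ _ hg hh =>
    obtain ⟨L, hL, rfl⟩ := hg
    obtain ⟨M, hM, rfl⟩ := hh
    exact ⟨L ++ M, fun β hβ => (List.mem_append.1 hβ).elim (hL β) (hM β), by simp⟩
  | inv g _ hg =>
    obtain ⟨L, hL, rfl⟩ := hg
    refine ⟨L.reverse, by simpa using hL, ?_⟩
    rw [List.prod_inv_reverse, List.map_map, ← List.map_reverse]
    congr 1
    refine List.map_congr_left fun β hβ => ?_
    exact ctx.refl_inv (ctx.SimpleHat_mem_Δhat (hL β (by simpa using hβ)))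

lemma list_prod_mem_What {L : List (V × ℚ × ℚ)} (hL : ∀ β ∈ L, β ∈ ctx.SimpleHat) :
    (L.map ctx.refl).prod ∈ ctx.What := by
  refine list_prod_mem fun g hg => ?_
  obtain ⟨β, hβ, rfl⟩ := List.mem_map.1 hg
  exact ctx.refl_mem_What (ctx.SimpleHat_mem_Δhat (hL β hβ))

/-- The exchange property for the affine Weyl group. -/
lemma exchange (L : List (V × ℚ × ℚ)) (hL : ∀ β ∈ L, β ∈ ctx.SimpleHat) {α : V × ℚ × ℚ}
    (hα : α ∈ ctx.SimpleHat) (hneg : (L.map ctx.refl).prod α ∉ ctx.PosHat) :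
    ∃ M : List (V × ℚ × ℚ), (∀ β ∈ M, β ∈ ctx.SimpleHat) ∧ M.length < L.length ∧
      (L.map ctx.refl).prod * ctx.refl α = (M.map ctx.refl).prod := by
  induction L with
  | nil => exact absurd (ctx.SimpleHat_subset hα) hneg
  | cons β L ih =>
    have hβ : β ∈ ctx.SimpleHat := hL β (by simp)
    have hL' : ∀ γ ∈ L, γ ∈ ctx.SimpleHat := fun γ hγ => hL γ (by simp [hγ])
    have hu := ctx.list_prod_mem_What hL'
    by_cases hpos : (L.map ctx.refl).prod α ∈ ctx.PosHat
    · have hβeq : (L.map ctx.refl).prod α = β := by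
        by_contra hne
        exact hneg (ctx.refl_simple_mem hβ hpos hne)
      refine ⟨L, hL', by simp, ?_⟩
      have hc := ctx.conj_refl hu (ctx.SimpleHat_mem_Δhat hα)
      rw [hβeq] at hc
      rw [List.map_cons, List.prod_cons, ← hc]
      have := ctx.refl_mul_self (ctx.SimpleHat_mem_Δhat hα)
      simp only [mul_assoc, inv_mul_cancel_left, this, mul_one]
    · obtain ⟨M, hM, hlen, hprod⟩ := ih hL' hpos
      refine ⟨β :: M, ?_, by simpa using hlen, ?_⟩
      · intro γ hγ
        rcases List.mem_cons.1 hγ with rfl | hγ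
        exacts [hβ, hM γ hγ]
      · simp only [List.map_cons, List.prod_cons, mul_assoc, hprod]

/-- An element of the affine Weyl group preserving the positive affine roots is trivial. -/
lemma eq_one_of_preserves_PosHat {w : (V × ℚ × ℚ) ≃ₗ[ℚ] (V × ℚ × ℚ)} (hw : w ∈ ctx.What)
    (h : ∀ x ∈ ctx.PosHat, w x ∈ ctx.PosHat) : w = 1 := by
  obtain ⟨L, hL, rfl⟩ := ctx.exists_simple_list hw
  induction hn : L.length using Nat.strong_induction_on generalizing L with
  | _ n ih =>
  rcases List.eq_nil_or_concat L with rfl | ⟨M, α, rfl⟩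
  · simp
  simp only [List.concat_eq_append] at *
  have hα : α ∈ ctx.SimpleHat := hL α (by simp)
  have hM : ∀ β ∈ M, β ∈ ctx.SimpleHat := fun β hβ => hL β (by simp [hβ])
  have hprod : ((M ++ [α]).map ctx.refl).prod = (M.map ctx.refl).prod * ctx.refl α := by simp
  have hneg : (M.map ctx.refl).prod α ∉ ctx.PosHat := by
    have := h α (ctx.SimpleHat_subset hα)
    rw [hprod, LinearEquiv.mul_apply, ctx.refl_self (ctx.SimpleHat_mem_Δhat hα), map_neg] at this
    intro hpos
    exact ctx.neg_notMem_PosHat hpos this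
  obtain ⟨K, hK, hlen, hKprod⟩ := ctx.exchange M hM hα hneg
  rw [hprod, hKprod] at h hw ⊢
  simp only [List.length_append, List.length_cons, List.length_nil] at hn
  exact ih K.length (by omega) K hK hw h rfl

/-! ### Minuscule elements -/

variable {w v : (V × ℚ × ℚ) ≃ₗ[ℚ] (V × ℚ × ℚ)}

lemma δhat_sub_emb (γ : V) : ctx.δhat - ctx.emb γ = (-γ, ((1 : ℤ) : ℚ), 0) := by
  simp [δhat, emb]

lemma δhat_sub_emb_mem {γ : V} (hγ : γ ∈ ctx.Δ) : ctx.δhat - ctx.emb γ ∈ ctx.PosHat := by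
  rw [δhat_sub_emb]
  exact ctx.mk_mem_PosHat (ctx.neg_mem_Δ γ hγ) le_rfl

lemma mem_idealOf_iff {γ : V} :
    γ ∈ ctx.idealOf w ↔ γ ∈ ctx.Pos ∧ -(w (ctx.δhat - ctx.emb γ)) ∈ ctx.PosHat :=
  ⟨fun h => ⟨h.1, h.2.2⟩, fun h => ⟨h.1, ctx.δhat_sub_emb_mem (ctx.mem_of_pos h.1), h.2⟩⟩

lemma idealOf_subset : ctx.idealOf w ⊆ ctx.Pos := fun _ h => h.1

lemma minuscule_apply_mem (hw : ctx.IsMinuscule w) {x : V × ℚ × ℚ} (hx : x ∈ ctx.PosHat)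
    (hne : ∀ γ ∈ ctx.idealOf w, x ≠ ctx.δhat - ctx.emb γ) : w x ∈ ctx.PosHat := by
  by_contra hcon
  have hN : x ∈ ctx.Nhat w :=
    ⟨hx, ctx.neg_mem_PosHat_of_notMem (ctx.What_mem_Δhat hw.1 (ctx.PosHat_subset hx)) hcon⟩
  obtain ⟨γ, hγ, rfl⟩ := hw.2 x hN
  exact hne γ ⟨hγ, hN⟩ rfl

lemma minuscule_emb_mem (hw : ctx.IsMinuscule w) {γ : V} (hγ : γ ∈ ctx.Pos) :
    w (ctx.emb γ) ∈ ctx.PosHat := by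
  refine ctx.minuscule_apply_mem hw (ctx.emb_mem_PosHat hγ) fun ν _ h => ?_
  simp [emb, δhat] at h

lemma minuscule_mk_mem (hw : ctx.IsMinuscule w) {γ : V} (hγ : γ ∈ ctx.Δ) {k : ℤ} (hk : 2 ≤ k) :
    w (γ, (k : ℚ), 0) ∈ ctx.PosHat := by
  refine ctx.minuscule_apply_mem hw (ctx.mk_mem_PosHat hγ (by omega)) fun ν _ h => ?_
  rw [δhat_sub_emb] at h
  simp only [Prod.mk.injEq, Int.cast_inj] at h
  omega

lemma minuscule_δhat_sub_emb_mem (hw : ctx.IsMinuscule w) {γ : V} (hγ : γ ∈ ctx.Pos)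
    (hI : γ ∉ ctx.idealOf w) : w (ctx.δhat - ctx.emb γ) ∈ ctx.PosHat := by
  by_contra hcon
  exact hI (ctx.mem_idealOf_iff.2 ⟨hγ, ctx.neg_mem_PosHat_of_notMem (ctx.What_mem_Δhat hw.1
    (ctx.PosHat_subset (ctx.δhat_sub_emb_mem (ctx.mem_of_pos hγ)))) hcon⟩)

/-- A negative affine root made positive by a minuscule element `w` is `γ - δ` with `γ` in the
ideal of `w`. -/
lemma exists_of_notMem_PosHat (hw : ctx.IsMinuscule w) {η : V} {l : ℤ} (hη : η ∈ ctx.Δ)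
    (hpos : w (η, (l : ℚ), 0) ∈ ctx.PosHat) (hneg : (η, (l : ℚ), (0 : ℚ)) ∉ ctx.PosHat) :
    η ∈ ctx.idealOf w ∧ l = -1 := by
  by_contra hcon
  have := ctx.minuscule_apply_mem hw
    (ctx.neg_mem_PosHat_of_notMem (ctx.mk_mem_Δhat hη l) hneg) ?_
  · rw [map_neg] at this
    exact ctx.neg_notMem_PosHat hpos this
  · intro γ hγ h
    rw [δhat_sub_emb] at h
    simp only [Prod.neg_mk, Prod.mk.injEq, neg_inj] at h
    refine hcon ⟨h.1 ▸ hγ, ?_⟩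
    have : -l = 1 := by exact_mod_cast h.2.1
    omega

/-- Two minuscule elements with the same ideal are equal. -/
lemma minuscule_eq (hw : ctx.IsMinuscule w) (hv : ctx.IsMinuscule v)
    (h : ctx.idealOf w = ctx.idealOf v) : w = v := by
  have hwv : v * w⁻¹ ∈ ctx.What := mul_mem hv.1 (inv_mem hw.1)
  have : v * w⁻¹ = 1 := by
    refine ctx.eq_one_of_preserves_PosHat hwv fun x hx => ?_
    have hy := ctx.What_mem_Δhat (inv_mem hw.1) (ctx.PosHat_subset hx)
    rw [LinearEquiv.mul_apply]
    have hwy : w (w⁻¹ x) ∈ ctx.PosHat := by rwa [apply_inv_apply]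
    generalize w⁻¹ x = y at hy hwy
    by_cases hyP : y ∈ ctx.PosHat
    · refine ctx.minuscule_apply_mem hv hyP ?_
      rintro γ hγ rfl
      exact ctx.neg_notMem_PosHat hwy (ctx.mem_idealOf_iff.1 (h ▸ hγ)).2
    · obtain ⟨η, hη, l, rfl⟩ := hy
      obtain ⟨hηI, rfl⟩ := ctx.exists_of_notMem_PosHat hw hη hwy hyP
      have := (ctx.mem_idealOf_iff.1 (h ▸ hηI)).2
      rw [← map_neg] at this
      simpa [δhat, emb] using this
  rw [mul_inv_eq_one] at this
  exact this.symm

/-- The ideal of a minuscule element is abelian. -/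
lemma isAbelianIdeal_idealOf (hw : ctx.IsMinuscule w) : ctx.IsAbelianIdeal (ctx.idealOf w) := by
  refine ⟨ctx.idealOf_subset, fun μ hμ ν hν hsum => ?_, fun γ hγ ν hν hsum => ?_⟩
  · have h1 := ctx.one_le_htHat (ctx.mem_idealOf_iff.1 hμ).2
    have h2 := ctx.one_le_htHat (ctx.mem_idealOf_iff.1 hν).2
    have h3 := ctx.one_le_htHat (ctx.minuscule_mk_mem hw (ctx.neg_mem_Δ _ hsum) le_rfl)
    have : (-(μ + ν), ((2 : ℤ) : ℚ), (0 : ℚ)) =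
        (ctx.δhat - ctx.emb μ) + (ctx.δhat - ctx.emb ν) := by
      simp [δhat, emb]
      constructor
      · abel
      · norm_num
    rw [this, map_add, map_add] at h3
    rw [map_neg] at h1 h2
    linarith
  · have hP := ctx.add_pos_mem γ (ctx.idealOf_subset hγ) ν hν hsum
    by_contra hcon
    have h1 := ctx.one_le_htHat (ctx.mem_idealOf_iff.1 hγ).2
    have h2 := ctx.one_le_htHat (ctx.minuscule_emb_mem hw hν)
    have h3 := ctx.one_le_htHat (ctx.minuscule_δhat_sub_emb_mem hw hP hcon)
    have : ctx.δhat - ctx.emb γ = (ctx.δhat - ctx.emb (γ + ν)) + ctx.emb ν := by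
      simp [δhat, emb]
    rw [this, map_neg, map_add, map_add] at h1
    linarith

/-- Left multiplication by a simple reflection enlarges the ideal of a minuscule element. -/
lemma refl_mul_minuscule (hw : ctx.IsMinuscule w) {β : V × ℚ × ℚ} (hβ : β ∈ ctx.SimpleHat)
    {γ : V} (hγ : γ ∈ ctx.Pos) (h : w (ctx.δhat - ctx.emb γ) = β) :
    ctx.IsMinuscule (ctx.refl β * w) ∧
      ctx.idealOf (ctx.refl β * w) = insert γ (ctx.idealOf w) := by
  have hβΔ := ctx.SimpleHat_mem_Δhat hβ
  have key : ∀ x, -((ctx.refl β * w) x) ∈ ctx.PosHat →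
      x = ctx.δhat - ctx.emb γ ∨ -(w x) ∈ ctx.PosHat := by
    intro x hx
    rw [LinearEquiv.mul_apply, ← map_neg] at hx
    by_cases hxβ : ctx.refl β (-(w x)) = β
    · left
      apply w.injective
      have := congrArg (ctx.refl β) hxβ
      rw [ctx.refl_refl hβΔ, ctx.refl_self hβΔ, neg_inj] at this
      rw [this, h]
    · right
      have := ctx.refl_simple_mem hβ hx hxβ
      rwa [ctx.refl_refl hβΔ] at this
  refine ⟨⟨mul_mem (ctx.refl_mem_What hβΔ) hw.1, fun x hx => ?_⟩, ?_⟩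
  · rcases key x hx.2 with rfl | hx'
    · exact ⟨γ, hγ, rfl⟩
    · exact hw.2 x ⟨hx.1, hx'⟩
  · ext ν
    rw [Set.mem_insert_iff, mem_idealOf_iff, mem_idealOf_iff]
    constructor
    · rintro ⟨hν, hx⟩
      rcases key _ hx with hx' | hx'
      · left
        simpa [δhat, emb] using hx'
      · exact Or.inr ⟨hν, hx'⟩
    · rintro (rfl | ⟨hν, hx⟩)
      · refine ⟨hγ, ?_⟩
        rw [LinearEquiv.mul_apply, h, ctx.refl_self hβΔ, neg_neg]
        exact ctx.SimpleHat_subset hβ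
      · refine ⟨hν, ?_⟩
        rw [LinearEquiv.mul_apply, ← map_neg]
        refine ctx.refl_simple_mem hβ hx fun heq => ?_
        rw [← h, ← map_neg] at heq
        have := w.injective heq
        refine ctx.neg_notMem_PosHat (ctx.δhat_sub_emb_mem (ctx.mem_of_pos hν)) ?_
        rw [this]
        exact ctx.δhat_sub_emb_mem (ctx.mem_of_pos hγ)

lemma notMem_idealOf_of_simple {β : V × ℚ × ℚ} (hβ : β ∈ ctx.SimpleHat) {γ : V}
    (h : w (ctx.δhat - ctx.emb γ) = β) : γ ∉ ctx.idealOf w := fun hγ =>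
  ctx.neg_notMem_PosHat (ctx.SimpleHat_subset hβ) (h ▸ (ctx.mem_idealOf_iff.1 hγ).2)

/-- A root of maximal height in the complement of the ideal of `w` inside a larger abelian ideal
corresponds to an affine simple root. -/
lemma apply_mem_SimpleHat (hw : ctx.IsMinuscule w) {K : Set V} (hK : ctx.IsAbelianIdeal K)
    (hsub : ctx.idealOf w ⊆ K) {γ : V} (hγ : γ ∈ K) (hγI : γ ∉ ctx.idealOf w)
    (hmax : ∀ ν ∈ K, ctx.ht γ < ctx.ht ν → ν ∈ ctx.idealOf w) :
    w (ctx.δhat - ctx.emb γ) ∈ ctx.SimpleHat := by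
  have hγP := hK.1 hγ
  have hβ₀ := ctx.minuscule_δhat_sub_emb_mem hw hγP hγI
  have key : ∀ (η ξ : V) (l : ℤ), η + ξ = -γ → η ∈ ctx.Δ → ξ ∈ ctx.Δ →
      w (η, (l : ℚ), 0) ∈ ctx.PosHat → w (ξ, ((1 - l : ℤ) : ℚ), 0) ∈ ctx.PosHat → 0 < l := by
    intro η ξ l hsum hη hξ hwη hwξ
    by_contra! hl
    have hξeq : -ξ = γ + η := by rw [← neg_neg γ, ← hsum]; abel
    have hγη : γ + η ∈ ctx.Δ := hξeq ▸ ctx.neg_mem_Δ ξ hξ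
    by_cases hηP : (η, (l : ℚ), (0 : ℚ)) ∈ ctx.PosHat
    · obtain rfl : l = 0 := le_antisymm hl (ctx.level_nonneg hηP)
      rw [Int.cast_zero, mk_zero_mem_PosHat] at hηP
      have h1 := hmax _ (hK.2.2 γ hγ η hηP hγη)
        (by rw [map_add]; linarith [ctx.ht_pos hηP])
      refine ctx.neg_notMem_PosHat hwξ ?_
      have h2 := (ctx.mem_idealOf_iff.1 h1).2
      rw [δhat_sub_emb, ← hξeq, neg_neg] at h2
      simpa using h2
    · exact hK.2.1 γ hγ η (hsub (ctx.exists_of_notMem_PosHat hw hη hwη hηP).1) hγη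
  obtain ⟨β, hβ, hpos⟩ := ctx.exists_simple_Bhat_pos hβ₀
  have hβP := ctx.SimpleHat_subset hβ
  have hhtβ := ctx.htHat_simple hβ
  obtain ⟨η, hη, l, hy⟩ := ctx.What_mem_Δhat (inv_mem hw.1) (ctx.PosHat_subset hβP)
  have hwy : w (η, (l : ℚ), 0) = β := by rw [← hy, apply_inv_apply]
  have hB : 0 < ctx.B (-γ) η := by
    rw [← hwy, ctx.Bhat_What hw.1, δhat_sub_emb, Bhat_apply] at hpos
    rw [ctx.B_symm]
    simpa using hpos
  have hsplit : w (-γ - η, ((1 - l : ℤ) : ℚ), 0) = w (ctx.δhat - ctx.emb γ) - β := by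
    rw [← hwy, ← map_sub, δhat_sub_emb]
    simp
  by_cases heq : -γ = η
  · subst heq
    have hht := ctx.one_le_htHat hβ₀
    have hδ : w (ctx.δhat - ctx.emb γ) = β + ((1 - l : ℤ) : ℚ) • ctx.δhat := by
      rw [← hwy]
      nth_rewrite 2 [← ctx.δhat_What hw.1]
      rw [← map_smul, ← map_add, δhat_sub_emb]
      simp [δhat]
    rcases lt_trichotomy l 1 with hl | rfl | hl
    · exfalso
      have := ctx.exists_of_notMem_PosHat hw hη (hwy ▸ hβP) ?_
      · exact ctx.pos_not_neg γ hγP this.1.1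
      · refine fun hmem => ctx.neg_notMem_PosHat hmem ?_
        obtain rfl : l = 0 := le_antisymm (by omega) (ctx.level_nonneg hmem)
        simpa [emb] using ctx.emb_mem_PosHat hγP
    · simpa [hδ] using hβ
    · exfalso
      have h2 := ctx.ht_pos ctx.θ_pos
      have hl' : (2 : ℚ) ≤ l := by exact_mod_cast (by omega : 2 ≤ l)
      rw [hδ, map_add, map_smul, hhtβ, smul_eq_mul, ctx.htHat_apply ctx.δhat] at hht
      simp only [δhat, map_zero] at hht
      push_cast at hht
      nlinarith
  · exfalso
    have hξ := ctx.sub_mem_of_B_pos (ctx.neg_mem_Δ γ (ctx.mem_of_pos hγP)) hη hB heq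
    have hxP : w (-γ - η, ((1 - l : ℤ) : ℚ), 0) ∈ ctx.PosHat := by
      by_contra hneg
      have h1 := ctx.one_le_htHat (ctx.neg_mem_PosHat_of_notMem
        (ctx.What_mem_Δhat hw.1 (ctx.mk_mem_Δhat hξ _)) hneg)
      have h2 := ctx.one_le_htHat hβ₀
      rw [hsplit, map_neg, map_sub] at h1
      linarith
    have h1 := key η (-γ - η) l (by abel) hη hξ (hwy ▸ hβP) hxP
    have h2 := key (-γ - η) η (1 - l) (by abel) hξ hη hxP (by
      rw [sub_sub_cancel, hwy]; exact hβP)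
    omega

lemma exists_cover (hw : ctx.IsMinuscule w) {K : Set V} (hK : ctx.IsAbelianIdeal K)
    (hsub : ctx.idealOf w ⊆ K) (hne : ctx.idealOf w ≠ K) :
    ∃ γ ∈ K, γ ∉ ctx.idealOf w ∧ w (ctx.δhat - ctx.emb γ) ∈ ctx.SimpleHat := by
  obtain ⟨ν, hν, hνI⟩ := Set.exists_of_ssubset (hsub.ssubset_of_ne hne)
  obtain ⟨γ, ⟨hγ, hγI⟩, hmax⟩ := Set.exists_max_image (K \ ctx.idealOf w) ctx.ht
    (ctx.pos_finite.subset fun _ h => hK.1 h.1) ⟨ν, hν, hνI⟩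
  refine ⟨γ, hγ, hγI, ctx.apply_mem_SimpleHat hw hK hsub hγ hγI fun ν hν hlt => ?_⟩
  by_contra hνI
  exact (hmax ν ⟨hν, hνI⟩).not_gt hlt

/-- The affine root `2δ - θ`, sent to the rootlet by a minuscule element. -/
def twoδSubθ : V × ℚ × ℚ := (-ctx.θ, 2, 0)

lemma apply_alpha0_add_δhat (hw : w ∈ ctx.What) :
    w ctx.alpha0 + ctx.δhat = w ctx.twoδSubθ := by
  nth_rewrite 1 [← ctx.δhat_What hw]
  rw [← map_add]
  congr 1
  simp [alpha0, δhat, twoδSubθ]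
  norm_num

lemma Bhat_apply_twoδSubθ (hw : w ∈ ctx.What) (γ : V) :
    ctx.Bhat (w (ctx.δhat - ctx.emb γ)) (w ctx.twoδSubθ) = ctx.B γ ctx.θ := by
  rw [ctx.Bhat_What hw, δhat_sub_emb, Bhat_apply]
  simp [twoδSubθ]

lemma refl_mul_apply_twoδSubθ (hw : w ∈ ctx.What) {γ : V}
    (hβ : w (ctx.δhat - ctx.emb γ) ∈ ctx.SimpleHat) (h : ctx.B γ ctx.θ = 0) :
    (ctx.refl (w (ctx.δhat - ctx.emb γ)) * w) ctx.twoδSubθ = w ctx.twoδSubθ := by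
  rw [LinearEquiv.mul_apply]
  refine ctx.refl_eq_of_Bhat_eq_zero (ctx.SimpleHat_mem_Δhat hβ) ?_
  rw [ctx.Bhat_apply_twoδSubθ hw, h]

lemma B_θ_eq_zero_of_simple (hw : w ∈ ctx.What) {γ : V} (hγ : γ ∈ ctx.Pos)
    (hβ : w (ctx.δhat - ctx.emb γ) ∈ ctx.SimpleHat)
    (hα : w ctx.twoδSubθ ∈ ctx.SimpleHat) : ctx.B γ ctx.θ = 0 := by
  refine le_antisymm ?_ (ctx.B_θ_nonneg hγ)
  rw [← ctx.Bhat_apply_twoδSubθ hw]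
  refine ctx.Bhat_simple_nonpos hβ hα fun heq => ?_
  have := w.injective heq
  simp [twoδSubθ, δhat, emb] at this

/-- Every abelian ideal containing the ideal of a minuscule element comes from a minuscule
element, with the same rootlet if only roots orthogonal to `θ` are added. -/
lemma exists_minuscule_of_subset (hw : ctx.IsMinuscule w) {K : Set V}
    (hK : ctx.IsAbelianIdeal K) (hsub : ctx.idealOf w ⊆ K)
    (h : (∀ γ ∈ K, γ ∉ ctx.idealOf w → ctx.B γ ctx.θ = 0) ∨ w ctx.twoδSubθ ∈ ctx.SimpleHat) :
    ∃ v, ctx.IsMinuscule v ∧ ctx.idealOf v = K ∧ v ctx.twoδSubθ = w ctx.twoδSubθ := by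
  induction hn : (K \ ctx.idealOf w).ncard using Nat.strong_induction_on generalizing w with
  | _ n ih =>
  by_cases hne : ctx.idealOf w = K
  · exact ⟨w, hw, hne, rfl⟩
  obtain ⟨γ, hγ, hγI, hβ⟩ := ctx.exists_cover hw hK hsub hne
  have h0 : ctx.B γ ctx.θ = 0 := h.elim (fun h => h γ hγ hγI)
    (ctx.B_θ_eq_zero_of_simple hw.1 (hK.1 hγ) hβ)
  obtain ⟨hv, hvI⟩ := ctx.refl_mul_minuscule hw hβ (hK.1 hγ) rfl
  have hvθ := ctx.refl_mul_apply_twoδSubθ hw.1 hβ h0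
  rw [← hvθ]
  refine ih _ ?_ hv (by rw [hvI]; exact Set.insert_subset hγ hsub) ?_ rfl
  · rw [← hn, hvI]
    refine Set.ncard_lt_ncard ?_ (ctx.pos_finite.subset fun _ h => hK.1 h.1)
    refine ⟨fun x hx => ⟨hx.1, fun hxI => hx.2 (Or.inr hxI)⟩, fun hss => ?_⟩
    exact (hss ⟨hγ, hγI⟩).2 (Or.inl rfl)
  · rw [hvθ]
    refine h.imp_left fun h ν hν hνI => h ν hν fun hνI' => hνI ?_
    rw [hvI]
    exact Or.inr hνI'

/-! ### Rootlets -/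

lemma minuscule_closure_pos (hw : ctx.IsMinuscule w) {y : V}
    (hy : y ∈ AddSubmonoid.closure ctx.Pos) :
    y = 0 ∨ (y ∈ ctx.Pos ∧ 1 ≤ ctx.htHat (w (ctx.emb y))) ∨
      2 ≤ ctx.htHat (w (ctx.emb y)) := by
  induction hy using AddSubmonoid.closure_induction with
  | mem x hx => exact Or.inr (Or.inl ⟨hx, ctx.one_le_htHat (ctx.minuscule_emb_mem hw hx)⟩)
  | zero => exact Or.inl rfl
  | add x y _ _ hx hy =>
    have hadd : ctx.emb (x + y) = ctx.emb x + ctx.emb y := by simp [emb]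
    by_cases hx0 : x = 0
    · rwa [hx0, zero_add]
    by_cases hy0 : y = 0
    · rwa [hy0, add_zero]
    have h1 : 1 ≤ ctx.htHat (w (ctx.emb x)) :=
      (hx.resolve_left hx0).elim And.right fun h => by linarith
    have h2 : 1 ≤ ctx.htHat (w (ctx.emb y)) :=
      (hy.resolve_left hy0).elim And.right fun h => by linarith
    right; right
    rw [hadd, map_add, map_add]
    linarith

lemma one_le_htHat_twoδSubθ (hw : ctx.IsMinuscule w) :
    1 ≤ ctx.htHat (w ctx.twoδSubθ) := by
  refine ctx.one_le_htHat ?_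
  simpa [twoδSubθ] using ctx.minuscule_mk_mem hw (ctx.neg_mem_Δ _ ctx.θ_mem) le_rfl

lemma two_le_htHat_δhat : 2 ≤ ctx.htHat ctx.δhat := by
  rw [htHat_apply]
  have := ctx.one_le_ht ctx.θ_pos
  simp only [δhat, map_zero]
  linarith

/-- The preimage under a minuscule element of an affine simple root is of level at most one,
unless it is `2δ - θ`. -/
lemma simple_preimage (hw : ctx.IsMinuscule w) {γ : V} (hγ : γ ∈ ctx.Δ) {k : ℤ} (hk : 1 ≤ k)
    (hβ : w (γ, (k : ℚ), 0) ∈ ctx.SimpleHat) :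
    (-γ ∈ ctx.Pos ∧ w (ctx.δhat - ctx.emb (-γ)) = w (γ, (k : ℚ), 0)) ∨
      w ctx.twoδSubθ = w (γ, (k : ℚ), 0) := by
  have hht := ctx.htHat_simple hβ
  have hδ := ctx.two_le_htHat_δhat
  rcases hk.eq_or_lt with rfl | hk
  · left
    have heq : ctx.δhat - ctx.emb (-γ) = (γ, ((1 : ℤ) : ℚ), 0) := by
      rw [δhat_sub_emb, neg_neg]
    refine ⟨(ctx.mem_pos_or_neg_pos γ hγ).resolve_left fun hP => ?_, by rw [heq]⟩
    have h1 := ctx.one_le_htHat (ctx.minuscule_emb_mem hw hP)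
    have h2 : ctx.δhat - ctx.emb (-γ) = ctx.δhat + ctx.emb γ := by simp [δhat, emb]
    rw [← heq, h2, map_add, ctx.δhat_What hw.1, map_add] at hht
    linarith
  · right
    have hy : γ + ctx.θ ∈ AddSubmonoid.closure ctx.Pos := by
      have := ctx.θ_highest _ (ctx.neg_mem_Δ _ hγ)
      rwa [sub_neg_eq_add, add_comm] at this
    have hT := ctx.one_le_htHat_twoδSubθ hw
    have hsplit : ((γ, (k : ℚ), 0) : V × ℚ × ℚ) =
        ctx.twoδSubθ + ((k : ℚ) - 2) • ctx.δhat + ctx.emb (γ + ctx.θ) := by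
      simp [twoδSubθ, δhat, emb]
    have hk' : (2 : ℚ) ≤ k := by exact_mod_cast hk
    have hmul : 0 ≤ ((k : ℚ) - 2) * ctx.htHat ctx.δhat := mul_nonneg (by linarith) (by linarith)
    rw [hsplit] at hht
    simp only [map_add, map_smul, smul_eq_mul, ctx.δhat_What hw.1] at hht
    rcases ctx.minuscule_closure_pos hw hy with h0 | h1 | h1
    · have hk2 : (k : ℚ) - 2 = 0 := by
        rw [h0] at hht
        simp only [emb, Prod.mk_zero_zero, map_zero] at hht
        nlinarith
      rw [hsplit, h0, hk2]
      simp [emb]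
    · linarith [h1.2]
    · linarith

lemma isMinuscule_one : ctx.IsMinuscule 1 ∧ ctx.idealOf 1 = ∅ := by
  refine ⟨⟨one_mem _, fun β hβ => (ctx.neg_notMem_PosHat hβ.1 hβ.2).elim⟩, ?_⟩
  exact Set.eq_empty_of_forall_notMem fun γ hγ => ctx.neg_notMem_PosHat hγ.2.1 hγ.2.2

lemma δhat_sub_emb_θ : ctx.δhat - ctx.emb ctx.θ = ctx.alpha0 := by
  rw [δhat_sub_emb, alpha0_eq]

lemma refl_alpha0_minuscule :
    ctx.IsMinuscule (ctx.refl ctx.alpha0) ∧ ctx.idealOf (ctx.refl ctx.alpha0) = {ctx.θ} := by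
  have := ctx.refl_mul_minuscule ctx.isMinuscule_one.1 ctx.alpha0_mem_SimpleHat ctx.θ_pos
    ctx.δhat_sub_emb_θ
  simpa [ctx.isMinuscule_one.2] using this

lemma refl_alpha0_twoδSubθ : ctx.refl ctx.alpha0 ctx.twoδSubθ = ctx.emb ctx.θ := by
  have hθ := (ctx.B_self_pos ctx.θ_mem).ne'
  have : ctx.sref ctx.θ (-ctx.θ) = ctx.θ := by
    rw [← ctx.sref_self ctx.θ_mem, ctx.sref_sref ctx.θ_mem]
  rw [twoδSubθ, refl_alpha0_mk, this, emb]
  congr 2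
  simp only [map_neg, LinearMap.neg_apply]
  field_simp
  ring

/-- The rootlet of a maximal abelian ideal is an affine simple root. -/
lemma rootlet_mem_SimpleHat_of_maximal (hw : ctx.IsMinuscule w)
    (hmax : ∀ K, ctx.IsAbelianIdeal K → ctx.idealOf w ⊆ K → ctx.idealOf w = K) :
    w ctx.twoδSubθ ∈ ctx.SimpleHat := by
  obtain ⟨β, hβ, hpos⟩ : ∃ β ∈ ctx.SimpleHat, 0 < (w⁻¹ β).2.1 := by
    by_contra! hcon
    have h : ∀ y ∈ AddSubmonoid.closure ctx.SimpleHat, (w⁻¹ y).2.1 ≤ 0 := by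
      intro y hy
      induction hy using AddSubmonoid.closure_induction with
      | mem x hx => exact hcon x hx
      | zero => simp
      | add x y _ _ hx hy =>
        rw [map_add, Prod.snd_add, Prod.fst_add]
        linarith
    have := h _ ctx.δhat_mem_closure_SimpleHat
    rw [ctx.δhat_What (inv_mem hw.1)] at this
    simp only [δhat] at this
    linarith
  obtain ⟨γ, hγ, k, hx⟩ := ctx.What_mem_Δhat (inv_mem hw.1) (ctx.SimpleHat_mem_Δhat hβ)
  rw [hx] at hpos
  have hk : 0 < k := Int.cast_pos.1 hpos
  have hwx : w (γ, (k : ℚ), 0) = β := by rw [← hx, apply_inv_apply]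
  rcases ctx.simple_preimage hw hγ hk (hwx ▸ hβ) with ⟨hP, h⟩ | h
  · rw [hwx] at h
    obtain ⟨h1, h2⟩ := ctx.refl_mul_minuscule hw hβ hP h
    refine (ctx.notMem_idealOf_of_simple hβ h ?_).elim
    rw [hmax _ (ctx.isAbelianIdeal_idealOf h1) (h2 ▸ Set.subset_insert _ _), h2]
    exact Set.mem_insert _ _
  · rw [h, hwx]
    exact hβ

lemma mem_SimpleLong_of_rootlet (hw : w ∈ ctx.What) {μ : V} (h : w ctx.twoδSubθ = ctx.emb μ)
    (hS : ctx.emb μ ∈ ctx.SimpleHat) : μ ∈ ctx.SimpleLong := by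
  refine ⟨?_, ?_⟩
  · rcases hS with ⟨α, hα, heq⟩ | heq
    · simp only [emb, Prod.mk.injEq] at heq
      exact heq.1 ▸ hα
    · simp [emb, alpha0] at heq
  · have := ctx.Bhat_What hw ctx.twoδSubθ ctx.twoδSubθ
    rw [h] at this
    simpa [Bhat_apply, emb, twoδSubθ] using this

/-- Every long positive root is a rootlet. -/
lemma exists_minuscule_rootlet {μ : V} (hμ : μ ∈ ctx.PosLong) :
    ∃ w, ctx.IsMinuscule w ∧ w ctx.twoδSubθ = ctx.emb μ := by
  by_contra hcon
  obtain ⟨ν, ⟨⟨hν, hlong⟩, hνn⟩, hmax⟩ := Set.exists_max_image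
    {ν | ν ∈ ctx.PosLong ∧ ¬∃ w, ctx.IsMinuscule w ∧ w ctx.twoδSubθ = ctx.emb ν} ctx.ht
    (ctx.pos_finite.subset fun _ h => h.1.1) ⟨μ, hμ, hcon⟩
  have hne : ν ≠ ctx.θ := by
    rintro rfl
    exact hνn ⟨_, ctx.refl_alpha0_minuscule.1, ctx.refl_alpha0_twoδSubθ⟩
  obtain ⟨α, hα, hneg⟩ := ctx.exists_simple_B_neg hν hlong hne
  have hαΔ := ctx.mem_of_pos hα.1
  have hαα := ctx.B_self_pos hαΔ
  have hνα : ν ≠ α := by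
    rintro rfl
    linarith
  have hν'P := ctx.sref_simple_mem hα hν hνα
  have hBν' := ctx.B_sref_left hαΔ ν
  obtain ⟨w, hw, hwν⟩ : ∃ w, ctx.IsMinuscule w ∧ w ctx.twoδSubθ = ctx.emb (ctx.sref α ν) := by
    by_contra hn
    have := hmax _ ⟨⟨hν'P, by rw [ctx.B_sref_self hαΔ, hlong]⟩, hn⟩
    rw [sref, map_sub, map_smul, ctx.ht_simple hα, smul_eq_mul, ctx.B_symm ν] at this
    have h2 := div_neg_of_neg_of_pos (mul_neg_of_pos_of_neg two_pos hneg) hαα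
    linarith
  have hβ := ctx.emb_mem_SimpleHat hα
  obtain ⟨γ, hγ, k, hx⟩ := ctx.What_mem_Δhat (inv_mem hw.1) (ctx.SimpleHat_mem_Δhat hβ)
  have hwx : w (γ, (k : ℚ), 0) = ctx.emb α := by rw [← hx, apply_inv_apply]
  have hBγ : ctx.B γ ctx.θ < 0 := by
    have := ctx.Bhat_What hw.1 (γ, (k : ℚ), 0) ctx.twoδSubθ
    rw [hwx, hwν, Bhat_apply, Bhat_apply] at this
    simp only [emb, twoδSubθ, map_neg, mul_zero, zero_mul, add_zero] at this
    rw [ctx.B_symm, hBν', ctx.B_symm] at this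
    linarith
  have hγneg : γ ∉ ctx.Pos := fun h => (ctx.B_θ_nonneg h).not_gt hBγ
  have hk : 1 ≤ k := by
    have hP : (γ, (k : ℚ), (0 : ℚ)) ∈ ctx.PosHat := by
      by_contra hn
      exact hγneg (ctx.exists_of_notMem_PosHat hw hγ
        (hwx ▸ ctx.SimpleHat_subset hβ) hn).1.1
    rcases (ctx.level_nonneg hP).eq_or_lt with rfl | hk
    · rw [Int.cast_zero, mk_zero_mem_PosHat] at hP
      exact (hγneg hP).elim
    · exact hk
  rcases ctx.simple_preimage hw hγ hk (hwx ▸ hβ) with ⟨hP, h⟩ | h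
  · rw [hwx] at h
    refine hνn ⟨_, (ctx.refl_mul_minuscule hw hβ hP h).1, ?_⟩
    rw [LinearEquiv.mul_apply, hwν]
    have := ctx.refl_mk hαΔ 0 (ctx.sref α ν) 0
    rw [ctx.sref_sref hαΔ] at this
    simpa [emb] using this
  · rw [hwx, hwν] at h
    simp only [emb, Prod.mk.injEq] at h
    have h2 := congrArg (ctx.sref α) h.1
    rw [ctx.sref_sref hαΔ, ctx.sref_self hαΔ] at h2
    exact ctx.pos_not_neg α hα.1 (h2 ▸ hν)

lemma exists_maximal {I : Set V} (hI : ctx.IsAbelianIdeal I) :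
    ∃ J, ctx.IsAbelianIdeal J ∧ I ⊆ J ∧ ∀ K, ctx.IsAbelianIdeal K → J ⊆ K → J = K := by
  have hfin : {J | ctx.IsAbelianIdeal J}.Finite :=
    ctx.pos_finite.finite_subsets.subset fun _ h => h.1
  obtain ⟨J, hIJ, hJ⟩ := hfin.exists_le_maximal hI
  exact ⟨J, hJ.1, hIJ, fun K hK hJK => hJ.eq_of_subset hK hJK⟩

/-! ### Uniqueness of maximal abelian ideals above a simple rootlet -/

lemma Bhat_covers_eq_zero (hw : ctx.IsMinuscule w) {γ γ' : V} (hγ : γ ∈ ctx.Pos)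
    (hγ' : γ' ∈ ctx.Pos) (hne : γ' ≠ γ) (h0 : ctx.B γ ctx.θ = 0) (h0' : ctx.B γ' ctx.θ = 0)
    (hβ : w (ctx.δhat - ctx.emb γ) ∈ ctx.SimpleHat)
    (hβ' : w (ctx.δhat - ctx.emb γ') ∈ ctx.SimpleHat) :
    ctx.Bhat (w (ctx.δhat - ctx.emb γ)) (w (ctx.δhat - ctx.emb γ')) = 0 := by
  refine le_antisymm (ctx.Bhat_simple_nonpos hβ hβ' fun h => ?_) ?_
  · have := w.injective h
    simp [δhat, emb] at this
    exact hne this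
  by_contra! hlt
  have hB : ctx.B γ γ' < 0 := by
    rw [ctx.Bhat_What hw.1, δhat_sub_emb, δhat_sub_emb, Bhat_apply] at hlt
    simpa using hlt
  have hθθ := ctx.B_self_pos ctx.θ_mem
  have hsum0 : γ + γ' ≠ 0 := fun h =>
    ctx.pos_not_neg γ hγ (by rwa [← eq_neg_of_add_eq_zero_right h])
  have hsum := ctx.add_mem_of_B_neg (ctx.mem_of_pos hγ) (ctx.mem_of_pos hγ') hB hsum0
  have hBsum : ctx.B (ctx.θ - (γ + γ')) ctx.θ = ctx.B ctx.θ ctx.θ := by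
    simp [h0, h0']
  have hsplit : (ctx.δhat - ctx.emb γ) + (ctx.δhat - ctx.emb γ') =
      ctx.twoδSubθ + ctx.emb (ctx.θ - (γ + γ')) := by
    simp [δhat, emb, twoδSubθ]
    constructor
    · abel
    · norm_num
  have hht := congrArg (fun x => ctx.htHat (w x)) hsplit
  simp only [map_add, ctx.htHat_simple hβ, ctx.htHat_simple hβ'] at hht
  have hT := ctx.one_le_htHat_twoδSubθ hw
  rcases ctx.minuscule_closure_pos hw (ctx.θ_highest _ hsum) with h | ⟨hP, -⟩ | h
  · rw [h] at hBsum
    simp only [map_zero, LinearMap.zero_apply] at hBsum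
    linarith
  · have := ctx.two_mul_B_θ hP (fun h => hsum0 (by simpa using h)) (by rw [hBsum]; exact hθθ.ne')
    linarith
  · linarith

/-- An ideal whose rootlet is affine simple is contained in a unique maximal abelian ideal. -/
lemma maximal_unique_of_simple (hw : ctx.IsMinuscule w) (hα : w ctx.twoδSubθ ∈ ctx.SimpleHat)
    {I J : Set V} (hI : ctx.IsAbelianIdeal I)
    (hImax : ∀ K, ctx.IsAbelianIdeal K → I ⊆ K → I = K) (hJ : ctx.IsAbelianIdeal J)
    (hJmax : ∀ K, ctx.IsAbelianIdeal K → J ⊆ K → J = K) (hwI : ctx.idealOf w ⊆ I)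
    (hwJ : ctx.idealOf w ⊆ J) : I = J := by
  induction hn : (ctx.Pos \ ctx.idealOf w).ncard using Nat.strong_induction_on
    generalizing w I J with
  | _ n ih =>
  by_cases hIw : ctx.idealOf w = I
  · exact hImax J hJ (hIw ▸ hwJ)
  by_cases hJw : ctx.idealOf w = J
  · exact (hJmax I hI (hJw ▸ hwI)).symm
  obtain ⟨γ, hγ, hγw, hβ⟩ := ctx.exists_cover hw hI hwI hIw
  obtain ⟨γ', hγ', hγw', hβ'⟩ := ctx.exists_cover hw hJ hwJ hJw
  have hγP := hI.1 hγ
  have hγP' := hJ.1 hγ'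
  have h0 := ctx.B_θ_eq_zero_of_simple hw.1 hγP hβ hα
  have h0' := ctx.B_θ_eq_zero_of_simple hw.1 hγP' hβ' hα
  obtain ⟨hv, hvI⟩ := ctx.refl_mul_minuscule hw hβ hγP rfl
  obtain ⟨hv', hvI'⟩ := ctx.refl_mul_minuscule hw hβ' hγP' rfl
  have hvθ := ctx.refl_mul_apply_twoδSubθ hw.1 hβ h0
  have hvθ' := ctx.refl_mul_apply_twoδSubθ hw.1 hβ' h0'
  have hlt : ∀ ν ∈ ctx.Pos, ν ∉ ctx.idealOf w →
      (ctx.Pos \ insert ν (ctx.idealOf w)).ncard < n := by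
    intro ν hν hνw
    rw [← hn]
    refine Set.ncard_lt_ncard ⟨fun x hx => ⟨hx.1, fun hxI => hx.2 (Or.inr hxI)⟩,
      fun hss => (hss ⟨hν, hνw⟩).2 (Or.inl rfl)⟩ (ctx.pos_finite.subset Set.sdiff_subset)
  have hsub : insert γ (ctx.idealOf w) ⊆ I := Set.insert_subset hγ hwI
  have hsub' : insert γ' (ctx.idealOf w) ⊆ J := Set.insert_subset hγ' hwJ
  rw [← hvI] at hsub
  rw [← hvI'] at hsub'
  by_cases hne : γ' = γ
  · subst hne
    exact ih _ (hvI ▸ hlt _ hγP hγw) hv (hvθ ▸ hα) hI hImax hJ hJmax hsub hsub' rfl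
  have horth := ctx.Bhat_covers_eq_zero hw hγP hγP' hne h0 h0' hβ hβ'
  have hfix : (ctx.refl (w (ctx.δhat - ctx.emb γ)) * w) (ctx.δhat - ctx.emb γ') =
      w (ctx.δhat - ctx.emb γ') := by
    rw [LinearEquiv.mul_apply]
    exact ctx.refl_eq_of_Bhat_eq_zero (ctx.SimpleHat_mem_Δhat hβ) horth
  obtain ⟨hu, huI⟩ := ctx.refl_mul_minuscule hv hβ' hγP' hfix
  obtain ⟨P, hP, hsubP, hPmax⟩ := ctx.exists_maximal (ctx.isAbelianIdeal_idealOf hu)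
  rw [huI, hvI] at hsubP
  trans P
  · refine ih _ (hvI ▸ hlt _ hγP hγw) hv (hvθ ▸ hα) hI hImax hP hPmax hsub ?_ rfl
    rw [hvI]
    exact (Set.subset_insert _ _).trans hsubP
  · refine ih _ (hvI' ▸ hlt _ hγP' hγw') hv' (hvθ' ▸ hα) hP hPmax hJ hJmax ?_ hsub' rfl
    rw [hvI']
    exact (Set.insert_subset_insert (Set.subset_insert _ _)).trans hsubP

/-! ### Minuscule elements whose ideal consists of roots not orthogonal to `θ` -/

lemma level_apply {a : (V × ℚ × ℚ) ≃ₗ[ℚ] (V × ℚ × ℚ)} (ha : a ∈ ctx.What)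
    (hfix : a (0, 0, 1) = (0, 0, 1)) (x : V × ℚ × ℚ) : (a x).2.1 = x.2.1 := by
  have := ctx.Bhat_What ha x (0, 0, 1)
  rw [hfix, Bhat_apply, Bhat_apply] at this
  simpa using this

/-- For an abelian ideal of roots not orthogonal to `θ`, the minuscule element is `a * s₀` with
`a` in the finite Weyl group. -/
lemma exists_finite_mul_refl_alpha0 {K : Set V} (hK : ctx.IsAbelianIdeal K) (hθ : ctx.θ ∈ K)
    (hne : ∀ γ ∈ K, ctx.B γ ctx.θ ≠ 0) :
    ∃ a ∈ ctx.What, a (0, 0, 1) = (0, 0, 1) ∧ ctx.IsMinuscule (a * ctx.refl ctx.alpha0) ∧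
      ctx.idealOf (a * ctx.refl ctx.alpha0) = K := by
  induction hn : K.ncard using Nat.strong_induction_on generalizing K with
  | _ n ih =>
  have hKfin : K.Finite := ctx.pos_finite.subset hK.1
  by_cases hKθ : K = {ctx.θ}
  · refine ⟨1, one_mem _, rfl, ?_⟩
    rw [one_mul, hKθ]
    exact ctx.refl_alpha0_minuscule
  obtain ⟨γ, hγ, hmin⟩ := Set.exists_min_image K ctx.ht hKfin ⟨_, hθ⟩
  have hγP := hK.1 hγ
  have hγθ : γ ≠ ctx.θ := by
    rintro rfl
    exact hKθ (Set.eq_singleton_iff_unique_mem.2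
      ⟨hγ, fun ν hν => ctx.eq_θ_of_ht_le (ctx.mem_of_pos (hK.1 hν)) (hmin ν hν)⟩)
  have hK' : ctx.IsAbelianIdeal (K \ {γ}) := by
    refine ⟨fun x hx => hK.1 hx.1, fun μ hμ ν hν => hK.2.1 μ hμ.1 ν hν.1,
      fun μ hμ ν hν hsum => ⟨hK.2.2 μ hμ.1 ν hν hsum, ?_⟩⟩
    rintro rfl
    have h1 := hmin μ hμ.1
    rw [map_add] at h1
    linarith [ctx.ht_pos hν]
  obtain ⟨a, ha, hfix, hw, hI⟩ := ih _ (hn ▸ Set.ncard_sdiff_singleton_lt_of_mem hγ hKfin) hK'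
    ⟨hθ, fun h => hγθ h.symm⟩ (fun ν hν => hne ν hν.1) rfl
  have hβ := ctx.apply_mem_SimpleHat hw hK (hI ▸ Set.sdiff_subset) hγ (by simp [hI])
    (fun ν hν hlt => by
      rw [hI]
      refine ⟨hν, ?_⟩
      rintro rfl
      exact lt_irrefl _ hlt)
  obtain ⟨hv, hvI⟩ := ctx.refl_mul_minuscule hw hβ hγP rfl
  refine ⟨ctx.refl ((a * ctx.refl ctx.alpha0) (ctx.δhat - ctx.emb γ)) * a,
    mul_mem (ctx.refl_mem_What (ctx.SimpleHat_mem_Δhat hβ)) ha, ?_, ?_⟩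
  · rw [LinearEquiv.mul_apply, hfix]
    refine ctx.refl_eq_of_Bhat_eq_zero (ctx.SimpleHat_mem_Δhat hβ) ?_
    have hlevel : ((a * ctx.refl ctx.alpha0) (ctx.δhat - ctx.emb γ)).2.1 = 0 := by
      rw [LinearEquiv.mul_apply, ctx.level_apply ha hfix, δhat_sub_emb, refl_alpha0_mk]
      have := ctx.two_mul_B_θ hγP hγθ (hne γ hγ)
      have hθθ := (ctx.B_self_pos ctx.θ_mem).ne'
      simp only [map_neg, LinearMap.neg_apply, mul_neg, this]
      field_simp
      simp
    rw [Bhat_apply, hlevel]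
    simp
  · rw [mul_assoc]
    refine ⟨hv, ?_⟩
    rw [hvI, hI, Set.insert_sdiff_singleton, Set.insert_eq_of_mem hγ]

/-- A minuscule element whose ideal contains `θ` has the same rootlet as some minuscule element
`a * s₀` with `a` in the finite Weyl group and a smaller ideal. -/
lemma exists_base (hw : ctx.IsMinuscule w) (hθ : ctx.θ ∈ ctx.idealOf w) :
    ∃ a ∈ ctx.What, a (0, 0, 1) = (0, 0, 1) ∧ ctx.IsMinuscule (a * ctx.refl ctx.alpha0) ∧
      ctx.idealOf (a * ctx.refl ctx.alpha0) ⊆ ctx.idealOf w ∧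
      a (ctx.emb ctx.θ) = w ctx.twoδSubθ := by
  have hI := ctx.isAbelianIdeal_idealOf hw
  have hK : ctx.IsAbelianIdeal {γ | γ ∈ ctx.idealOf w ∧ ctx.B γ ctx.θ ≠ 0} := by
    refine ⟨fun γ hγ => hI.1 hγ.1, fun μ hμ ν hν => hI.2.1 μ hμ.1 ν hν.1,
      fun μ hμ ν hν hsum => ⟨hI.2.2 μ hμ.1 ν hν hsum, ?_⟩⟩
    have h1 := lt_of_le_of_ne (ctx.B_θ_nonneg (hI.1 hμ.1)) hμ.2.symm
    have h2 := ctx.B_θ_nonneg hν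
    rw [map_add, LinearMap.add_apply]
    exact (add_pos_of_pos_of_nonneg h1 h2).ne'
  obtain ⟨a, ha, hfix, hv, hvI⟩ := ctx.exists_finite_mul_refl_alpha0 hK
    ⟨hθ, (ctx.B_self_pos ctx.θ_mem).ne'⟩ (fun γ hγ => hγ.2)
  have hsub : ctx.idealOf (a * ctx.refl ctx.alpha0) ⊆ ctx.idealOf w := by
    rw [hvI]
    exact fun γ hγ => hγ.1
  refine ⟨a, ha, hfix, hv, hsub, ?_⟩
  obtain ⟨u, hu, huI, huθ⟩ := ctx.exists_minuscule_of_subset hv hI hsub (Or.inl (by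
    intro γ hγ hγn
    by_contra h
    exact hγn (hvI ▸ ⟨hγ, h⟩)))
  rw [ctx.minuscule_eq hu hw huI, LinearEquiv.mul_apply, refl_alpha0_twoδSubθ] at huθ
  exact huθ.symm

lemma apply_emb_mem_of_orthogonal {a : (V × ℚ × ℚ) ≃ₗ[ℚ] (V × ℚ × ℚ)}
    (hv : ctx.IsMinuscule (a * ctx.refl ctx.alpha0)) {γ : V} (hγ : γ ∈ ctx.Pos)
    (h0 : ctx.B γ ctx.θ = 0) : a (ctx.emb γ) ∈ ctx.PosHat := by
  have := ctx.minuscule_emb_mem hv hγ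
  rwa [LinearEquiv.mul_apply, ctx.refl_eq_of_Bhat_eq_zero
    (ctx.SimpleHat_mem_Δhat ctx.alpha0_mem_SimpleHat)] at this
  rw [Bhat_apply]
  simp [alpha0, emb, ctx.B_symm ctx.θ, h0]

lemma base_unique {a b : (V × ℚ × ℚ) ≃ₗ[ℚ] (V × ℚ × ℚ)} (ha : a ∈ ctx.What) (hb : b ∈ ctx.What)
    (hafix : a (0, 0, 1) = (0, 0, 1)) (hbfix : b (0, 0, 1) = (0, 0, 1))
    (hva : ctx.IsMinuscule (a * ctx.refl ctx.alpha0))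
    (hvb : ctx.IsMinuscule (b * ctx.refl ctx.alpha0))
    (hab : a (ctx.emb ctx.θ) = b (ctx.emb ctx.θ)) : a = b := by
  have hu : b⁻¹ * a ∈ ctx.What := mul_mem (inv_mem hb) ha
  have hufix : (b⁻¹ * a) (0, 0, 1) = (0, 0, 1) := by
    rw [LinearEquiv.mul_apply, hafix, ← hbfix, inv_apply_apply, hbfix]
  have huθ : (b⁻¹ * a) (ctx.emb ctx.θ) = ctx.emb ctx.θ := by
    rw [LinearEquiv.mul_apply, hab, inv_apply_apply]
  suffices b⁻¹ * a = 1 by rwa [inv_mul_eq_one, eq_comm] at this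
  refine ctx.eq_one_of_preserves_PosHat hu fun x hx => ?_
  obtain ⟨γ₁, hγ₁, k, hux⟩ := ctx.What_mem_Δhat hu (ctx.PosHat_subset hx)
  have hlevel := ctx.level_apply hu hufix x
  rw [hux] at hlevel ⊢
  simp only at hlevel
  rcases hx with ⟨γ, hγ, rfl⟩ | ⟨γ, hγ, l, hl, rfl⟩
  · rw [hlevel, mk_zero_mem_PosHat]
    rw [hlevel] at hux
    have hB : ctx.B γ₁ ctx.θ = ctx.B γ ctx.θ := by
      have := ctx.Bhat_What hu (γ, 0, 0) (ctx.emb ctx.θ)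
      rw [huθ, hux, Bhat_apply, Bhat_apply] at this
      simpa [emb] using this
    refine (ctx.mem_pos_or_neg_pos γ₁ hγ₁).resolve_right fun hneg => ?_
    have h1 := ctx.B_θ_nonneg hneg
    have h2 := ctx.B_θ_nonneg hγ
    rw [map_neg, LinearMap.neg_apply] at h1
    have h3 := ctx.apply_emb_mem_of_orthogonal hva hγ (by linarith)
    have h4 := ctx.apply_emb_mem_of_orthogonal hvb hneg
      (by rw [map_neg, LinearMap.neg_apply]; linarith)
    have h5 : b (ctx.emb (-γ₁)) = -a (ctx.emb γ) := by
      have h6 : ctx.emb (-γ₁) = -(b⁻¹ * a) (ctx.emb γ) := by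
        rw [emb, emb, hux]
        simp
      rw [h6, LinearEquiv.mul_apply, map_neg, apply_inv_apply]
    rw [h5] at h4
    exact ctx.neg_notMem_PosHat h3 h4
  · refine ctx.mk_mem_PosHat hγ₁ ?_
    obtain rfl : k = l := Int.cast_inj.1 hlevel
    exact hl

lemma θ_mem_idealOf {α : V} (hα : α ∈ ctx.Δ)
    (h : w ctx.alpha0 + ctx.δhat = ctx.emb α) : ctx.θ ∈ ctx.idealOf w := by
  refine ctx.mem_idealOf_iff.2 ⟨ctx.θ_pos, ?_⟩
  rw [δhat_sub_emb_θ, eq_sub_of_add_eq h, neg_sub]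
  exact ctx.δhat_sub_emb_mem hα

lemma maximal_unique_of_rootlet {α : V} (hα : α ∈ ctx.simple) {I J : Set V}
    (hI : ctx.IsAbelianIdeal I) (hImax : ∀ K, ctx.IsAbelianIdeal K → I ⊆ K → I = K)
    (hJ : ctx.IsAbelianIdeal J) (hJmax : ∀ K, ctx.IsAbelianIdeal K → J ⊆ K → J = K)
    (hIα : ctx.HasRootlet I α) (hJα : ctx.HasRootlet J α) : I = J := by
  have key : ∀ I, ctx.HasRootlet I α → ∃ a ∈ ctx.What, a (0, 0, 1) = (0, 0, 1) ∧
      ctx.IsMinuscule (a * ctx.refl ctx.alpha0) ∧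
      ctx.idealOf (a * ctx.refl ctx.alpha0) ⊆ I ∧ a (ctx.emb ctx.θ) = ctx.emb α := by
    rintro _ ⟨w, hw, rfl, h⟩
    have := ctx.exists_base hw (ctx.θ_mem_idealOf (ctx.mem_of_pos hα.1) h)
    rwa [← ctx.apply_alpha0_add_δhat hw.1, h] at this
  obtain ⟨a, ha, hafix, hva, haI, haθ⟩ := key I hIα
  obtain ⟨b, hb, hbfix, hvb, hbJ, hbθ⟩ := key J hJα
  obtain rfl := ctx.base_unique ha hb hafix hbfix hva hvb (haθ.trans hbθ.symm)
  refine ctx.maximal_unique_of_simple hva ?_ hI hImax hJ hJmax haI hbJ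
  rw [LinearEquiv.mul_apply, refl_alpha0_twoδSubθ, haθ]
  exact ctx.emb_mem_SimpleHat hα

end RootSystemCtx

/-- the rootlet map restricts to a bijection between maximal
abelian ideals and long simple roots. -/
theorem statement_7 {V : Type*} [AddCommGroup V] [Module ℚ V] (ctx : RootSystemCtx V) :
    (∀ I : Set V, ctx.IsAbelianIdeal I →
        (∀ K, ctx.IsAbelianIdeal K → I ⊆ K → I = K) →
        ∀ μ, ctx.HasRootlet I μ → μ ∈ ctx.SimpleLong) ∧
    (∀ α ∈ ctx.SimpleLong, ∃! I : Set V, ctx.IsAbelianIdeal I ∧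
        (∀ K, ctx.IsAbelianIdeal K → I ⊆ K → I = K) ∧ ctx.HasRootlet I α) := by
  refine ⟨?_, fun α hα => ?_⟩
  · rintro _ - hmax μ ⟨w, hw, rfl, h⟩
    rw [ctx.apply_alpha0_add_δhat hw.1] at h
    exact ctx.mem_SimpleLong_of_rootlet hw.1 h
      (h ▸ ctx.rootlet_mem_SimpleHat_of_maximal hw hmax)
  · obtain ⟨w, hw, hwα⟩ := ctx.exists_minuscule_rootlet ⟨hα.1.1, hα.2⟩
    obtain ⟨I, hI, hsub, hmax⟩ := ctx.exists_maximal (ctx.isAbelianIdeal_idealOf hw)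
    obtain ⟨v, hv, hvI, hvα⟩ := ctx.exists_minuscule_of_subset hw hI hsub
      (Or.inr (hwα ▸ ctx.emb_mem_SimpleHat hα.1))
    have hIα : ctx.HasRootlet I α :=
      ⟨v, hv, hvI, by rw [ctx.apply_alpha0_add_δhat hv.1, hvα, hwα]⟩
    exact ⟨I, ⟨hI, hmax, hIα⟩, fun J hJ =>
      ctx.maximal_unique_of_rootlet hα.1 hJ.1 hJ.2.1 hI hmax hJ.2.2 hIα⟩
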